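/- arXiv:1312.4995 — 4 statements merged into one kernel-verified Lean document; each statement's English description precedes it below -/
import Mathlib

section
/- Let I ⊆ ℝ be an open interval and let c : I × S¹ → ℝ² be a smooth map such that each c(t,·) is a smooth immersion; write c_t = ∂_t c, and let |c'|, v, D_s be computed from c(t,·). Then for every integer k ≥ 0 and all (t,θ): ∂_t ( D_s^k log|c'| ) = D_s^k ⟨D_s c_t, v⟩ − Σ_{j=0}^{k−1} binom(k, j+1) · (D_s^{k−j} log|c'|) · D_s^j ⟨D_s c_t, v⟩. -/
noncomputable section
open Real MeasureTheory intervalIntegral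
open scoped RealInnerProductSpace

/-- We identify the plane with `EuclideanSpace ℝ (Fin 2)`. -/
abbrev R2 := EuclideanSpace ℝ (Fin 2)

/-- A smooth `2π`-periodic map, i.e. a smooth map on the circle `S¹`. -/
def SmoothLoop {E : Type*} [NormedAddCommGroup E] [NormedSpace ℝ E] (f : ℝ → E) : Prop :=
  ContDiff ℝ (⊤ : ℕ∞) f ∧ Function.Periodic f (2 * π)

/-- A smooth immersion `S¹ → ℝ²`: a smooth `2π`-periodic map with nowhere vanishing derivative. -/
def IsImmersion (c : ℝ → R2) : Prop :=
  SmoothLoop c ∧ ∀ θ : ℝ, deriv c θ ≠ 0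

/-- The speed `|c'|`. -/
def speed (c : ℝ → R2) (θ : ℝ) : ℝ := ‖deriv c θ‖

/-- Arc-length derivative `D_s = (1/|c'|) ∂_θ`. -/
def Ds {E : Type*} [NormedAddCommGroup E] [NormedSpace ℝ E] (c : ℝ → R2) (f : ℝ → E) :
    ℝ → E := fun θ => (speed c θ)⁻¹ • deriv f θ

/-- Unit tangent vector `v = c'/|c'|`. -/
def tangentV (c : ℝ → R2) (θ : ℝ) : R2 := (speed c θ)⁻¹ • deriv c θ

/-- Rotation by `π/2` in the plane: `J(x,y) = (-y,x)`. -/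
def Jrot (w : R2) : R2 := (WithLp.equiv 2 (Fin 2 → ℝ)).symm ![-(w 1), w 0]

/-- Unit normal vector `n = J v`. -/
def normalV (c : ℝ → R2) (θ : ℝ) : R2 := Jrot (tangentV c θ)

/-- Curvature `κ = ⟨D_s v, n⟩`. -/
def curv (c : ℝ → R2) (θ : ℝ) : ℝ := ⟪Ds c (tangentV c) θ, normalV c θ⟫

/-- `log |c'|`. -/
def logSpeed (c : ℝ → R2) (θ : ℝ) : ℝ := Real.log (speed c θ)

/-- Length `ℓ_c = ∫_{S¹} |c'| dθ` of the curve. -/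
def len (c : ℝ → R2) : ℝ := ∫ θ in (0:ℝ)..(2 * π), speed c θ

/-- A smooth path of immersions, parametrized by `[0,1]`. -/
def IsImmPath (c : ℝ → ℝ → R2) : Prop :=
  ContDiffOn ℝ (⊤ : ℕ∞) (fun p : ℝ × ℝ => c p.1 p.2) (Set.Icc 0 1 ×ˢ Set.univ) ∧
  ∀ t ∈ Set.Icc (0:ℝ) 1, IsImmersion (c t)

/-- Length `Len^G` of a path with respect to the metric `G`. -/
def pathLen (G : (ℝ → R2) → (ℝ → R2) → (ℝ → R2) → ℝ) (c : ℝ → ℝ → R2) : ℝ :=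
  ∫ t in (0:ℝ)..1,
    Real.sqrt (G (c t) (fun θ => deriv (fun τ => c τ θ) t) (fun θ => deriv (fun τ => c τ θ) t))

/-- Geodesic distance induced by `G`: the infimum of `Len^G` over smooth paths of immersions. -/
def distG (G : (ℝ → R2) → (ℝ → R2) → (ℝ → R2) → ℝ) (c₁ c₂ : ℝ → R2) : ℝ :=
  sInf { L : ℝ | ∃ c : ℝ → ℝ → R2, IsImmPath c ∧ c 0 = c₁ ∧ c 1 = c₂ ∧ L = pathLen G c }

/-- `G` assigns to every smooth immersion a nonnegative symmetric bilinear form on smooth maps. -/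
def IsMetric (G : (ℝ → R2) → (ℝ → R2) → (ℝ → R2) → ℝ) : Prop :=
  ∀ c : ℝ → R2, IsImmersion c →
    (∀ h k : ℝ → R2, SmoothLoop h → SmoothLoop k → G c h k = G c k h) ∧
    (∀ h₁ h₂ k : ℝ → R2, SmoothLoop h₁ → SmoothLoop h₂ → SmoothLoop k →
      G c (h₁ + h₂) k = G c h₁ k + G c h₂ k) ∧
    (∀ (a : ℝ) (h k : ℝ → R2), SmoothLoop h → SmoothLoop k →
      G c (a • h) k = a * G c h k) ∧
    (∀ h : ℝ → R2, SmoothLoop h → 0 ≤ G c h h)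

/-- The metric `G` is bounded below by the Sobolev `H^n(ds)` inner product:
`∫_{S¹} (|h|² + |D_s^n h|²) |c'| dθ ≤ A · G_c(h,h)`. -/
def SobolevBound (n : ℕ) (A : ℝ) (G : (ℝ → R2) → (ℝ → R2) → (ℝ → R2) → ℝ) : Prop :=
  ∀ c h : ℝ → R2, IsImmersion c → SmoothLoop h →
    (∫ θ in (0:ℝ)..(2 * π), (‖h θ‖ ^ 2 + ‖(Ds c)^[n] h θ‖ ^ 2) * speed c θ) ≤ A * G c h h

/-- Joint smoothness on `I × ℝ`. -/
def Sm9 {E : Type*} [NormedAddCommGroup E] [NormedSpace ℝ E] (I : Set ℝ) (F : ℝ → ℝ → E) : Prop :=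
  ∀ t ∈ I, ∀ θ : ℝ, ContDiffAt ℝ (⊤ : ℕ∞) (fun p : ℝ × ℝ => F p.1 p.2) (t, θ)

section aux9
variable {E : Type*} [NormedAddCommGroup E] [NormedSpace ℝ E] {I : Set ℝ}

theorem Sm9.diff {F : ℝ → ℝ → E} (h : Sm9 I F) {t : ℝ} (ht : t ∈ I) (θ : ℝ) :
    DifferentiableAt ℝ (fun p : ℝ × ℝ => F p.1 p.2) (t, θ) :=
  (h t ht θ).differentiableAt (by simp)

theorem Sm9.hasDerivAt_snd {F : ℝ → ℝ → E} (h : Sm9 I F) {t : ℝ} (ht : t ∈ I) (θ : ℝ) :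
    HasDerivAt (F t) (fderiv ℝ (fun p : ℝ × ℝ => F p.1 p.2) (t, θ) (0, 1)) θ := by
  have h1 : HasDerivAt (fun y : ℝ => (t, y)) ((0 : ℝ), (1 : ℝ)) θ :=
    (hasDerivAt_const θ t).prodMk (hasDerivAt_id θ)
  exact (h.diff ht θ).hasFDerivAt.comp_hasDerivAt θ h1

theorem Sm9.hasDerivAt_fst {F : ℝ → ℝ → E} (h : Sm9 I F) {t : ℝ} (ht : t ∈ I) (θ : ℝ) :
    HasDerivAt (fun τ => F τ θ) (fderiv ℝ (fun p : ℝ × ℝ => F p.1 p.2) (t, θ) (1, 0)) t := by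
  have h1 : HasDerivAt (fun τ : ℝ => (τ, θ)) ((1 : ℝ), (0 : ℝ)) t :=
    (hasDerivAt_id t).prodMk (hasDerivAt_const t θ)
  exact (h.diff ht θ).hasFDerivAt.comp_hasDerivAt (f := fun τ : ℝ => (τ, θ)) t h1

theorem Sm9.differentiableAt_snd {F : ℝ → ℝ → E} (h : Sm9 I F) {t : ℝ} (ht : t ∈ I) (θ : ℝ) :
    DifferentiableAt ℝ (F t) θ := (h.hasDerivAt_snd ht θ).differentiableAt

theorem Sm9.differentiableAt_fst {F : ℝ → ℝ → E} (h : Sm9 I F) {t : ℝ} (ht : t ∈ I) (θ : ℝ) :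
    DifferentiableAt ℝ (fun τ => F τ θ) t := (h.hasDerivAt_fst ht θ).differentiableAt

theorem ev9 (hI : IsOpen I) {t : ℝ} (ht : t ∈ I) (θ : ℝ) :
    ∀ᶠ p : ℝ × ℝ in nhds (t, θ), p.1 ∈ I :=
  continuous_fst.continuousAt.eventually (hI.mem_nhds ht)

theorem Sm9.congr {F G : ℝ → ℝ → E} (hI : IsOpen I) (h : Sm9 I F)
    (hFG : ∀ t ∈ I, ∀ θ, G t θ = F t θ) : Sm9 I G := fun t ht θ =>
  (h t ht θ).congr_of_eventuallyEq ((ev9 hI ht θ).mono fun p hp => hFG p.1 hp p.2)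

theorem Sm9.fder {F : ℝ → ℝ → E} (h : Sm9 I F) {t : ℝ} (ht : t ∈ I) (θ : ℝ) :
    ContDiffAt ℝ (⊤ : ℕ∞) (fderiv ℝ (fun p : ℝ × ℝ => F p.1 p.2)) (t, θ) :=
  (h t ht θ).fderiv_right (by simp)

theorem Sm9.fder_apply {F : ℝ → ℝ → E} (h : Sm9 I F) (w : ℝ × ℝ) :
    Sm9 I (fun t θ => fderiv ℝ (fun p : ℝ × ℝ => F p.1 p.2) (t, θ) w) := fun _ ht θ =>
  (h.fder ht θ).clm_apply contDiffAt_const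

theorem Sm9.deriv_snd {F : ℝ → ℝ → E} (hI : IsOpen I) (h : Sm9 I F) :
    Sm9 I (fun t θ => deriv (F t) θ) :=
  (h.fder_apply (0, 1)).congr hI fun _ ht θ => (h.hasDerivAt_snd ht θ).deriv

theorem Sm9.deriv_fst {F : ℝ → ℝ → E} (hI : IsOpen I) (h : Sm9 I F) :
    Sm9 I (fun t θ => deriv (fun τ => F τ θ) t) :=
  (h.fder_apply (1, 0)).congr hI fun _ ht θ => (h.hasDerivAt_fst ht θ).deriv

theorem Sm9.comm {F : ℝ → ℝ → E} (hI : IsOpen I) (h : Sm9 I F) {t : ℝ} (ht : t ∈ I) (θ : ℝ) :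
    deriv (fun τ => deriv (F τ) θ) t = deriv (fun y => deriv (fun τ => F τ y) t) θ := by
  have e1 : (fun τ => deriv (F τ) θ) =ᶠ[nhds t]
      fun τ => fderiv ℝ (fun p : ℝ × ℝ => F p.1 p.2) (τ, θ) (0, 1) :=
    (Filter.eventually_of_mem (hI.mem_nhds ht)) fun τ hτ => (h.hasDerivAt_snd hτ θ).deriv
  have e2 : (fun y => deriv (fun τ => F τ y) t) =
      fun y => fderiv ℝ (fun p : ℝ × ℝ => F p.1 p.2) (t, y) (1, 0) :=
    funext fun y => (h.hasDerivAt_fst ht y).deriv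
  rw [e1.deriv_eq, e2, ((h.fder_apply (0, 1)).hasDerivAt_fst ht θ).deriv,
    ((h.fder_apply (1, 0)).hasDerivAt_snd ht θ).deriv]
  have hd : DifferentiableAt ℝ (fderiv ℝ (fun p : ℝ × ℝ => F p.1 p.2)) (t, θ) :=
    (h.fder ht θ).differentiableAt (by simp)
  have key : ∀ w w' : ℝ × ℝ,
      fderiv ℝ (fun p : ℝ × ℝ => fderiv ℝ (fun p : ℝ × ℝ => F p.1 p.2) (p.1, p.2) w) (t, θ) w' =
        fderiv ℝ (fderiv ℝ (fun p : ℝ × ℝ => F p.1 p.2)) (t, θ) w' w := by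
    intro w w'
    have := hd.hasFDerivAt.clm_apply (hasFDerivAt_const w (t, θ))
    simp only [Prod.mk.eta]
    rw [this.fderiv]
    simp
  rw [key, key]
  exact ((h t ht θ).isSymmSndFDerivAt (by simpa using (by exact_mod_cast le_top : ((2:ℕ∞) : WithTop ℕ∞) ≤ ((⊤:ℕ∞) : WithTop ℕ∞)))).eq _ _

end aux9

section main9
variable {I : Set ℝ} {c : ℝ → ℝ → R2}

theorem speed9_pos (hcim : ∀ t ∈ I, IsImmersion (c t)) {t : ℝ} (ht : t ∈ I) (θ : ℝ) :
    0 < speed (c t) θ := norm_pos_iff.2 ((hcim t ht).2 θ)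

theorem speed9_sm (hI : IsOpen I) (hc : Sm9 I c) (hcim : ∀ t ∈ I, IsImmersion (c t)) :
    Sm9 I (fun t θ => speed (c t) θ) := fun t ht θ =>
  (hc.deriv_snd hI t ht θ).norm ℝ ((hcim t ht).2 θ)

theorem log9_sm (hI : IsOpen I) (hc : Sm9 I c) (hcim : ∀ t ∈ I, IsImmersion (c t)) :
    Sm9 I (fun t θ => logSpeed (c t) θ) := fun t ht θ =>
  (speed9_sm hI hc hcim t ht θ).log (speed9_pos hcim ht θ).ne'

theorem Ds9_sm {E : Type*} [NormedAddCommGroup E] [NormedSpace ℝ E]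
    (hI : IsOpen I) (hc : Sm9 I c) (hcim : ∀ t ∈ I, IsImmersion (c t))
    {F : ℝ → ℝ → E} (hF : Sm9 I F) : Sm9 I (fun t => Ds (c t) (F t)) := fun t ht θ =>
  ((speed9_sm hI hc hcim t ht θ).inv (speed9_pos hcim ht θ).ne').smul (hF.deriv_snd hI t ht θ)

theorem iter9_sm {E : Type*} [NormedAddCommGroup E] [NormedSpace ℝ E]
    (hI : IsOpen I) (hc : Sm9 I c) (hcim : ∀ t ∈ I, IsImmersion (c t))
    {F : ℝ → ℝ → E} (hF : Sm9 I F) (k : ℕ) : Sm9 I (fun t => (Ds (c t))^[k] (F t)) := by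
  induction k with
  | zero => exact hF
  | succ k ih =>
    simp only [Function.iterate_succ_apply']
    exact Ds9_sm hI hc hcim ih

/-- `⟨D_s c_t, v⟩` -/
def uu9 (c : ℝ → ℝ → R2) (t : ℝ) : ℝ → ℝ :=
  fun x => (⟪Ds (c t) (fun y => deriv (fun τ => c τ y) t) x, tangentV (c t) x⟫ : ℝ)

theorem uu9_sm (hI : IsOpen I) (hc : Sm9 I c) (hcim : ∀ t ∈ I, IsImmersion (c t)) :
    Sm9 I (uu9 c) := fun t ht θ =>
  (Ds9_sm hI hc hcim (hc.deriv_fst hI) t ht θ).inner ℝ (Ds9_sm hI hc hcim hc t ht θ)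

theorem speed9_deriv (hI : IsOpen I) (hc : Sm9 I c) (hcim : ∀ t ∈ I, IsImmersion (c t))
    {t : ℝ} (ht : t ∈ I) (θ : ℝ) :
    HasDerivAt (fun τ => speed (c τ) θ) (uu9 c t θ * speed (c t) θ) t := by
  have hp := speed9_pos hcim ht θ
  have h1 : HasDerivAt (fun τ => deriv (c τ) θ) (deriv (fun y => deriv (fun τ => c τ y) t) θ) t := by
    rw [← hc.comm hI ht θ]
    exact ((hc.deriv_snd hI).differentiableAt_fst ht θ).hasDerivAt
  have h2 := ((speed9_sm hI hc hcim).differentiableAt_fst ht θ).hasDerivAt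
  have h3 := h1.norm_sq
  have h4 := h2.pow 2
  have h5 := h3.unique h4
  refine h2.congr_deriv ?_
  simp only [uu9, Ds, tangentV, inner_smul_left, inner_smul_right]
  rw [real_inner_comm] at h5
  simp only [conj_trivial]
  simp only [Nat.cast_ofNat, Nat.add_one_sub_one, pow_one] at h5
  field_simp
  linarith

theorem comm9 (hI : IsOpen I) (hc : Sm9 I c) (hcim : ∀ t ∈ I, IsImmersion (c t))
    {F : ℝ → ℝ → ℝ} (hF : Sm9 I F) {t : ℝ} (ht : t ∈ I) (θ : ℝ) :
    deriv (fun τ => Ds (c τ) (F τ) θ) t =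
      Ds (c t) (fun y => deriv (fun τ => F τ y) t) θ - uu9 c t θ * Ds (c t) (F t) θ := by
  have hp := speed9_pos hcim ht θ
  have h1 : HasDerivAt (fun τ => deriv (F τ) θ) (deriv (fun y => deriv (fun τ => F τ y) t) θ) t := by
    rw [← hF.comm hI ht θ]
    exact ((hF.deriv_snd hI).differentiableAt_fst ht θ).hasDerivAt
  have h2 := ((speed9_deriv hI hc hcim ht θ).inv hp.ne').mul h1
  have h3 : (fun τ => Ds (c τ) (F τ) θ) =
    (fun τ => speed (c τ) θ)⁻¹ * (fun τ => deriv (F τ) θ) := rfl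
  rw [h3, h2.deriv]
  simp only [Ds, smul_eq_mul, Pi.inv_apply]
  field_simp
  ring

theorem main9 (hI : IsOpen I) (hc : Sm9 I c) (hcim : ∀ t ∈ I, IsImmersion (c t)) (k : ℕ) :
    ∀ t ∈ I, ∀ θ : ℝ, deriv (fun τ => (Ds (c τ))^[k] (logSpeed (c τ)) θ) t
        = (Ds (c t))^[k] (uu9 c t) θ
          - ∑ j ∈ Finset.range k, (k.choose (j + 1) : ℝ)
              * (Ds (c t))^[k - j] (logSpeed (c t)) θ * (Ds (c t))^[j] (uu9 c t) θ := by
  have hL := iter9_sm hI hc hcim (log9_sm hI hc hcim)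
  have hU := iter9_sm hI hc hcim (uu9_sm hI hc hcim)
  induction k with
  | zero =>
    intro t ht θ
    have hp := speed9_pos hcim ht θ
    simp only [Function.iterate_zero, id, Finset.range_zero, Finset.sum_empty, sub_zero]
    have := (speed9_deriv hI hc hcim ht θ).log hp.ne'
    rw [show (fun τ => logSpeed (c τ) θ) = fun τ => Real.log (speed (c τ) θ) from rfl, this.deriv]
    field_simp
  | succ k ih =>
    intro t ht θ
    have hp := speed9_pos hcim ht θ
    have e : (fun τ => (Ds (c τ))^[k+1] (logSpeed (c τ)) θ) =
      fun τ => Ds (c τ) ((Ds (c τ))^[k] (logSpeed (c τ))) θ := by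
      simp only [Function.iterate_succ_apply']
    rw [e, comm9 hI hc hcim (hL k) ht θ, show (fun y => deriv (fun τ => (Ds (c τ))^[k] (logSpeed (c τ)) y) t) = _ from funext fun y => ih t ht y]
    have dL : ∀ m, HasDerivAt ((Ds (c t))^[m] (logSpeed (c t)))
        (speed (c t) θ * (Ds (c t))^[m+1] (logSpeed (c t)) θ) θ := by
      intro m
      refine ((hL m).differentiableAt_snd ht θ).hasDerivAt.congr_deriv ?_
      rw [Function.iterate_succ_apply', Ds, smul_eq_mul, mul_inv_cancel_left₀ hp.ne']
    have dU : ∀ m, HasDerivAt ((Ds (c t))^[m] (uu9 c t))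
        (speed (c t) θ * (Ds (c t))^[m+1] (uu9 c t) θ) θ := by
      intro m
      refine ((hU m).differentiableAt_snd ht θ).hasDerivAt.congr_deriv ?_
      rw [Function.iterate_succ_apply', Ds, smul_eq_mul, mul_inv_cancel_left₀ hp.ne']
    have dS := (dU k).fun_sub (HasDerivAt.fun_sum (u := Finset.range k) fun j _ =>
      ((dL (k - j)).const_mul (k.choose (j + 1) : ℝ)).fun_mul (dU j))
    have e2 : uu9 c t θ * Ds (c t) ((Ds (c t))^[k] (logSpeed (c t))) θ =
        (Ds (c t))^[k+1] (logSpeed (c t)) θ * (Ds (c t))^[0] (uu9 c t) θ := by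
      rw [Function.iterate_succ_apply', mul_comm]; rfl
    rw [e2]
    conv_lhs => rw [Ds, dS.deriv]
    generalize (fun m => (Ds (c t))^[m] (logSpeed (c t)) θ) = L at *
    have alg : ∀ (L U : ℕ → ℝ),
        ∑ j ∈ Finset.range (k+1), ((k+1).choose (j + 1) : ℝ) * L (k + 1 - j) * U j =
        ∑ j ∈ Finset.range k, (k.choose (j + 1) : ℝ) * (L (k - j + 1) * U j + L (k - j) * U (j+1))
          + L (k+1) * U 0 := by
      intro L U
      simp only [mul_add, Finset.sum_add_distrib]
      have h1 : ∀ j ∈ Finset.range (k+1),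
          ((k+1).choose (j + 1) : ℝ) * L (k + 1 - j) * U j =
          (k.choose (j+1) : ℝ) * (L (k - j + 1) * U j) + (k.choose j : ℝ) * (L (k+1-j) * U j) := by
        intro j hj
        have : k + 1 - j = k - j + 1 := by have := Finset.mem_range.1 hj; omega
        rw [this, Nat.choose_succ_succ]; push_cast; ring
      rw [Finset.sum_congr rfl h1, Finset.sum_add_distrib, Finset.sum_range_succ,
        Finset.sum_range_succ' (fun j => (k.choose j : ℝ) * (L (k+1-j) * U j))]
      simp
      ring
    rw [alg (fun m => (Ds (c t))^[m] (logSpeed (c t)) θ) (fun m => (Ds (c t))^[m] (uu9 c t) θ)]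
    have e3 : ∑ j ∈ Finset.range k,
        ((k.choose (j + 1) : ℝ) * (speed (c t) θ * (Ds (c t))^[k - j + 1] (logSpeed (c t)) θ) *
          (Ds (c t))^[j] (uu9 c t) θ + (k.choose (j + 1) : ℝ) * (Ds (c t))^[k - j] (logSpeed (c t)) θ *
          (speed (c t) θ * (Ds (c t))^[j+1] (uu9 c t) θ)) = speed (c t) θ * 
        ∑ j ∈ Finset.range k, (k.choose (j + 1) : ℝ) *
          ((Ds (c t))^[k - j + 1] (logSpeed (c t)) θ * (Ds (c t))^[j] (uu9 c t) θ
            + (Ds (c t))^[k - j] (logSpeed (c t)) θ * (Ds (c t))^[j+1] (uu9 c t) θ) := by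
      rw [Finset.mul_sum]
      exact Finset.sum_congr rfl fun j _ => by ring
    rw [e3, smul_eq_mul, ← mul_sub, inv_mul_cancel_left₀ hp.ne']
    ring

end main9

/-- the variational formula for `D_s^k log|c'|` along a time-dependent curve:
`∂_t(D_s^k log|c'|) = D_s^k⟨D_s c_t, v⟩ − Σ_{j=0}^{k−1} C(k,j+1) (D_s^{k−j} log|c'|) D_s^j⟨D_s c_t, v⟩`. -/
theorem statement_9 (I : Set ℝ) (hI : IsOpen I) (hIconn : I.OrdConnected)
    (c : ℝ → ℝ → R2)
    (hc : ContDiffOn ℝ (⊤ : ℕ∞) (fun p : ℝ × ℝ => c p.1 p.2) (I ×ˢ Set.univ))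
    (hcim : ∀ t ∈ I, IsImmersion (c t)) :
    ∀ t ∈ I, ∀ (k : ℕ) (θ : ℝ),
      deriv (fun τ => (Ds (c τ))^[k] (logSpeed (c τ)) θ) t
        = (Ds (c t))^[k]
            (fun x => (⟪Ds (c t) (fun y => deriv (fun τ => c τ y) t) x, tangentV (c t) x⟫ : ℝ)) θ
          - ∑ j ∈ Finset.range k, (k.choose (j + 1) : ℝ)
              * (Ds (c t))^[k - j] (logSpeed (c t)) θ
              * (Ds (c t))^[j]
                  (fun x =>
                    (⟪Ds (c t) (fun y => deriv (fun τ => c τ y) t) x, tangentV (c t) x⟫ : ℝ)) θ := by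
  have hc' : Sm9 I c := fun t ht θ =>
    hc.contDiffAt ((hI.prod isOpen_univ).mem_nhds ⟨ht, Set.mem_univ θ⟩)
  intro t ht k θ
  exact main9 hI hc' hcim k t ht θ
end
end

section
/- Let I ⊆ ℝ be an open interval and let c : I × S¹ → ℝ² be a smooth map such that each c(t,·) is a smooth immersion; write c_t = ∂_t c, and let |c'|, v, n, D_s, κ be computed from c(t,·). Then for every integer k ≥ 0 and all (t,θ): ∂_t ( D_s^k κ ) = D_s^{k+1} ⟨D_s c_t, n⟩ − Σ_{j=0}^{k} binom(k+1, j+1) · (D_s^{k−j} κ) · D_s^j ⟨D_s c_t, v⟩. -/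
noncomputable section
open Real MeasureTheory intervalIntegral
open scoped RealInnerProductSpace

namespace S10

/-- Smoothness of a two-variable scalar function on `I × ℝ`. -/
def Sm (I : Set ℝ) (F : ℝ → ℝ → ℝ) : Prop :=
  ContDiffOn ℝ (⊤ : ℕ∞) (fun p : ℝ × ℝ => F p.1 p.2) (I ×ˢ Set.univ)

variable {I : Set ℝ}

lemma isOpenU (hI : IsOpen I) : IsOpen (I ×ˢ (Set.univ : Set ℝ)) := hI.prod isOpen_univ

lemma Sm.at {F : ℝ → ℝ → ℝ} (hF : Sm I F) (hI : IsOpen I) {t : ℝ} (ht : t ∈ I) (θ : ℝ) :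
    ContDiffAt ℝ (⊤ : ℕ∞) (fun p : ℝ × ℝ => F p.1 p.2) (t, θ) :=
  hF.contDiffAt ((isOpenU hI).mem_nhds ⟨ht, trivial⟩)

lemma Sm.hasF {F : ℝ → ℝ → ℝ} (hF : Sm I F) (hI : IsOpen I) {t : ℝ} (ht : t ∈ I) (θ : ℝ) :
    HasFDerivAt (fun p : ℝ × ℝ => F p.1 p.2)
      (fderiv ℝ (fun p : ℝ × ℝ => F p.1 p.2) (t, θ)) (t, θ) :=
  ((hF.at hI ht θ).differentiableAt (by simp)).hasFDerivAt

lemma hasDerivAt_snd_of {g : ℝ × ℝ → ℝ} {L : ℝ × ℝ →L[ℝ] ℝ} {t θ : ℝ}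
    (h : HasFDerivAt g L (t, θ)) : HasDerivAt (fun y => g (t, y)) (L (0, 1)) θ :=
  HasFDerivAt.comp_hasDerivAt (f := fun y : ℝ => (t, y)) θ h
    ((hasDerivAt_const θ t).prodMk (hasDerivAt_id θ))

lemma hasDerivAt_fst_of {g : ℝ × ℝ → ℝ} {L : ℝ × ℝ →L[ℝ] ℝ} {t θ : ℝ}
    (h : HasFDerivAt g L (t, θ)) : HasDerivAt (fun τ => g (τ, θ)) (L (1, 0)) t :=
  HasFDerivAt.comp_hasDerivAt (f := fun τ : ℝ => (τ, θ)) t h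
    ((hasDerivAt_id t).prodMk (hasDerivAt_const t θ))

lemma Sm.hθ {F : ℝ → ℝ → ℝ} (hF : Sm I F) (hI : IsOpen I) {t : ℝ} (ht : t ∈ I) (θ : ℝ) :
    HasDerivAt (F t) (fderiv ℝ (fun p : ℝ × ℝ => F p.1 p.2) (t, θ) (0, 1)) θ :=
  hasDerivAt_snd_of (hF.hasF hI ht θ)

lemma Sm.ht {F : ℝ → ℝ → ℝ} (hF : Sm I F) (hI : IsOpen I) {t : ℝ} (ht : t ∈ I) (θ : ℝ) :
    HasDerivAt (fun τ => F τ θ) (fderiv ℝ (fun p : ℝ × ℝ => F p.1 p.2) (t, θ) (1, 0)) t :=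
  hasDerivAt_fst_of (hF.hasF hI ht θ)

lemma Sm.dθ {F : ℝ → ℝ → ℝ} (hF : Sm I F) (hI : IsOpen I) :
    Sm I (fun t θ => deriv (F t) θ) := by
  have h1 : ContDiffOn ℝ (⊤ : ℕ∞) (fderiv ℝ (fun p : ℝ × ℝ => F p.1 p.2)) (I ×ˢ Set.univ) :=
    ContDiffOn.fderiv_of_isOpen hF (isOpenU hI) (by simp)
  have h2 := h1.clm_apply (contDiffOn_const (c := ((0 : ℝ), (1 : ℝ))))
  exact h2.congr fun p hp => (hF.hθ hI hp.1 p.2).deriv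

lemma Sm.dt {F : ℝ → ℝ → ℝ} (hF : Sm I F) (hI : IsOpen I) :
    Sm I (fun t θ => deriv (fun τ => F τ θ) t) := by
  have h1 : ContDiffOn ℝ (⊤ : ℕ∞) (fderiv ℝ (fun p : ℝ × ℝ => F p.1 p.2)) (I ×ˢ Set.univ) :=
    ContDiffOn.fderiv_of_isOpen hF (isOpenU hI) (by simp)
  have h2 := h1.clm_apply (contDiffOn_const (c := ((1 : ℝ), (0 : ℝ))))
  exact h2.congr fun p hp => (hF.ht hI hp.1 p.2).deriv

lemma Sm.symm {F : ℝ → ℝ → ℝ} (hF : Sm I F) (hI : IsOpen I) {t : ℝ} (ht : t ∈ I) (θ : ℝ) :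
    deriv (fun τ => deriv (F τ) θ) t = deriv (fun y => deriv (fun τ => F τ y) t) θ := by
  set g : ℝ × ℝ → ℝ := fun p => F p.1 p.2 with hg
  have h1 : ContDiffOn ℝ (⊤ : ℕ∞) (fderiv ℝ g) (I ×ˢ Set.univ) :=
    ContDiffOn.fderiv_of_isOpen hF (isOpenU hI) (by simp)
  have h2 : HasFDerivAt (fderiv ℝ g) (fderiv ℝ (fderiv ℝ g) (t, θ)) (t, θ) :=
    ((h1.contDiffAt ((isOpenU hI).mem_nhds ⟨ht, trivial⟩)).differentiableAt
      (by simp)).hasFDerivAt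
  have hs : IsSymmSndFDerivAt ℝ g (t, θ) := (hF.at hI ht θ).isSymmSndFDerivAt
    (by simp only [minSmoothness_of_isRCLikeNormedField]; exact WithTop.coe_le_coe.2 (le_top : (2 : ℕ∞) ≤ ⊤))
  have e1 : (fun τ => deriv (F τ) θ) =ᶠ[nhds t] fun τ => fderiv ℝ g (τ, θ) (0, 1) := by
    filter_upwards [hI.mem_nhds ht] with τ hτ using (hF.hθ hI hτ θ).deriv
  have e2 : (fun y => deriv (fun τ => F τ y) t) = fun y => fderiv ℝ g (t, y) (1, 0) := by
    funext y; exact (hF.ht hI ht y).deriv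
  rw [e1.deriv_eq, e2]
  have k1 := hasDerivAt_fst_of (h2.clm_apply (hasFDerivAt_const ((0 : ℝ), (1 : ℝ)) (t, θ)))
  have k2 := hasDerivAt_snd_of (h2.clm_apply (hasFDerivAt_const ((1 : ℝ), (0 : ℝ)) (t, θ)))
  rw [k1.deriv, k2.deriv]
  simpa using hs.eq (1, 0) (0, 1)

lemma Sm.hasθ {F : ℝ → ℝ → ℝ} (hF : Sm I F) (hI : IsOpen I) {t : ℝ} (ht : t ∈ I) (θ : ℝ) :
    HasDerivAt (F t) (deriv (F t) θ) θ := (hF.hθ hI ht θ).differentiableAt.hasDerivAt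

lemma Sm.hast {F : ℝ → ℝ → ℝ} (hF : Sm I F) (hI : IsOpen I) {t : ℝ} (ht : t ∈ I) (θ : ℝ) :
    HasDerivAt (fun τ => F τ θ) (deriv (fun τ => F τ θ) t) t :=
  (hF.ht hI ht θ).differentiableAt.hasDerivAt

/-- The arc-length derivative of a two-variable scalar function. -/
def D (s : ℝ → ℝ → ℝ) (F : ℝ → ℝ → ℝ) : ℝ → ℝ → ℝ := fun t θ => (s t θ)⁻¹ * deriv (F t) θ

lemma Sm.D {s F : ℝ → ℝ → ℝ} (hs : Sm I s) (hs0 : ∀ t ∈ I, ∀ θ, s t θ ≠ 0) (hF : Sm I F)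
    (hI : IsOpen I) : Sm I (D s F) :=
  (ContDiffOn.inv hs fun p hp => hs0 p.1 hp.1 p.2).mul (hF.dθ hI)

lemma Sm.Dk {s F : ℝ → ℝ → ℝ} (hs : Sm I s) (hs0 : ∀ t ∈ I, ∀ θ, s t θ ≠ 0) (hF : Sm I F)
    (hI : IsOpen I) (k : ℕ) : Sm I ((S10.D s)^[k] F) := by
  induction k with
  | zero => exact hF
  | succ k ih => rw [Function.iterate_succ_apply']; exact hs.D hs0 ih hI

/-- Commutator of the time derivative and the arc-length derivative. -/
lemma comm {s F A : ℝ → ℝ → ℝ} (hs : Sm I s) (hs0 : ∀ t ∈ I, ∀ θ, s t θ ≠ 0) (hF : Sm I F)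
    (hI : IsOpen I) (hA : ∀ t ∈ I, ∀ θ, deriv (fun τ => s τ θ) t = A t θ * s t θ)
    {t : ℝ} (ht : t ∈ I) (θ : ℝ) :
    deriv (fun τ => D s F τ θ) t
      = D s (fun t θ => deriv (fun τ => F τ θ) t) t θ - A t θ * D s F t θ := by
  have h1 := (hs.hast hI ht θ).fun_inv (hs0 t ht θ)
  have h2 := h1.mul ((hF.dθ hI).hast hI ht θ)
  have h3 := h2.deriv
  simp only [D]
  refine h3.trans ?_
  rw [hF.symm hI ht θ, hA t ht θ]
  have := hs0 t ht θ
  field_simp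
  ring

lemma main {s K A B : ℝ → ℝ → ℝ} (hs : Sm I s) (hs0 : ∀ t ∈ I, ∀ θ, s t θ ≠ 0) (hK : Sm I K)
    (hAs : Sm I A) (hB : Sm I B)
    (hI : IsOpen I) (hA : ∀ t ∈ I, ∀ θ, deriv (fun τ => s τ θ) t = A t θ * s t θ)
    (h0 : ∀ t ∈ I, ∀ θ, deriv (fun τ => K τ θ) t = D s B t θ - A t θ * K t θ)
    {t : ℝ} (ht : t ∈ I) (k : ℕ) (θ : ℝ) :
    deriv (fun τ => (D s)^[k] K τ θ) t = (D s)^[k + 1] B t θ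
      - ∑ j ∈ Finset.range (k + 1), ((k + 1).choose (j + 1) : ℝ)
        * (D s)^[k - j] K t θ * (D s)^[j] A t θ := by
  induction k generalizing θ with
  | zero => simp [h0 t ht θ]; ring
  | succ k ih =>
    have e := comm hs hs0 (hs.Dk hs0 hK hI k) hI hA ht θ
    rw [← Function.iterate_succ_apply' (D s) k K] at e
    rw [e]
    have hd : HasDerivAt (fun y => deriv (fun τ => (D s)^[k] K τ y) t)
        (deriv ((D s)^[k + 1] B t) θ - ∑ j ∈ Finset.range (k + 1),
          (((k + 1).choose (j + 1) : ℝ) * deriv ((D s)^[k - j] K t) θ * (D s)^[j] A t θ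
          + ((k + 1).choose (j + 1) : ℝ) * (D s)^[k - j] K t θ * deriv ((D s)^[j] A t) θ)) θ := by
      rw [show (fun y => deriv (fun τ => (D s)^[k] K τ y) t) = _ from funext ih]
      refine ((hs.Dk hs0 hB hI (k + 1)).hasθ hI ht θ).sub (HasDerivAt.fun_sum fun j _ => ?_)
      exact (((hs.Dk hs0 hK hI (k - j)).hasθ hI ht θ).const_mul _).mul
        ((hs.Dk hs0 hAs hI j).hasθ hI ht θ)
    have e2 : D s (fun t θ => deriv (fun τ => (D s)^[k] K τ θ) t) t θ
        = (D s)^[k + 2] B t θ - ∑ j ∈ Finset.range (k + 1),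
          (((k + 1).choose (j + 1) : ℝ) * (D s)^[k + 1 - j] K t θ * (D s)^[j] A t θ
          + ((k + 1).choose (j + 1) : ℝ) * (D s)^[k - j] K t θ * (D s)^[j + 1] A t θ) := by
      have : D s (fun t θ => deriv (fun τ => (D s)^[k] K τ θ) t) t θ = _ :=
        congrArg (fun z => (s t θ)⁻¹ * z) hd.deriv
      rw [this]
      rw [mul_sub, Finset.mul_sum, Function.iterate_succ_apply' (D s) (k + 1) B]
      congr 1
      refine Finset.sum_congr rfl fun j hj => ?_
      have hj' : k + 1 - j = (k - j) + 1 := by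
        have := Finset.mem_range.1 hj; omega
      rw [hj', Function.iterate_succ_apply' (D s) (k - j), Function.iterate_succ_apply' (D s) j]
      simp only [D]
      ring
    rw [e2, Finset.sum_add_distrib]
    have e3 : ∑ j ∈ Finset.range (k + 1 + 1), ((k + 1 + 1).choose (j + 1) : ℝ)
          * (D s)^[k + 1 - j] K t θ * (D s)^[j] A t θ
        = ∑ j ∈ Finset.range (k + 1 + 1), ((k + 1).choose (j + 1) : ℝ)
          * (D s)^[k + 1 - j] K t θ * (D s)^[j] A t θ
        + ∑ j ∈ Finset.range (k + 1 + 1), ((k + 1).choose j : ℝ)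
          * (D s)^[k + 1 - j] K t θ * (D s)^[j] A t θ := by
      rw [← Finset.sum_add_distrib]
      refine Finset.sum_congr rfl fun j _ => ?_
      rw [Nat.choose_succ_succ (k + 1) j]; push_cast; ring
    rw [e3, Finset.sum_range_succ (fun j => ((k + 1).choose (j + 1) : ℝ)
          * (D s)^[k + 1 - j] K t θ * (D s)^[j] A t θ) (k + 1),
      Finset.sum_range_succ' (fun j => ((k + 1).choose j : ℝ)
          * (D s)^[k + 1 - j] K t θ * (D s)^[j] A t θ) (k + 1)]
    simp only [Nat.choose_succ_self, Nat.add_sub_add_right, Nat.choose_zero_right]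
    simp
    ring

/-- Base case in coordinates. -/
lemma base {s X Y : ℝ → ℝ → ℝ} (hs : Sm I s) (hs0 : ∀ t ∈ I, ∀ θ, s t θ ≠ 0)
    (hX : Sm I X) (hY : Sm I Y) (hI : IsOpen I)
    (hsq : ∀ t ∈ I, ∀ θ, s t θ ^ 2 = deriv (X t) θ ^ 2 + deriv (Y t) θ ^ 2)
    {A B : ℝ → ℝ → ℝ} (hB : Sm I B)
    (hA : ∀ t ∈ I, ∀ θ, A t θ = D s (fun t θ => deriv (fun τ => X τ θ) t) t θ * D s X t θ
      + D s (fun t θ => deriv (fun τ => Y τ θ) t) t θ * D s Y t θ)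
    (hBe : ∀ t ∈ I, ∀ θ, B t θ = - D s (fun t θ => deriv (fun τ => X τ θ) t) t θ * D s Y t θ
      + D s (fun t θ => deriv (fun τ => Y τ θ) t) t θ * D s X t θ) :
    (∀ t ∈ I, ∀ θ, deriv (fun τ => s τ θ) t = A t θ * s t θ) ∧
    ∀ t ∈ I, ∀ θ, deriv (fun τ => - D s (D s X) τ θ * D s Y τ θ + D s (D s Y) τ θ * D s X τ θ) t
      = D s B t θ
        - A t θ * (- D s (D s X) t θ * D s Y t θ + D s (D s Y) t θ * D s X t θ) := by
  have hst : ∀ t ∈ I, ∀ θ, deriv (fun τ => s τ θ) t = A t θ * s t θ := by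
    intro t ht θ
    have h1 := (hs.hast hI ht θ).fun_pow 2
    have h2 := (((hX.dθ hI).hast hI ht θ).fun_pow 2).fun_add (((hY.dθ hI).hast hI ht θ).fun_pow 2)
    have e : (fun τ => s τ θ ^ 2) =ᶠ[nhds t]
        fun τ => deriv (X τ) θ ^ 2 + deriv (Y τ) θ ^ 2 := by
      filter_upwards [hI.mem_nhds ht] with τ hτ using hsq τ hτ θ
    have h3 := h1.unique (h2.congr_of_eventuallyEq e)
    rw [hX.symm hI ht θ, hY.symm hI ht θ] at h3
    rw [hA t ht θ]
    have := hs0 t ht θ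
    simp only [D]
    norm_num at h3
    field_simp
    linarith
  refine ⟨hst, fun t ht θ => ?_⟩
  have sX := hs.D hs0 hX hI
  have sY := hs.D hs0 hY hI
  have one : ∀ t ∈ I, ∀ θ, D s X t θ ^ 2 + D s Y t θ ^ 2 = 1 := by
    intro t ht θ
    have := hs0 t ht θ
    simp only [D]
    rw [mul_pow, mul_pow, ← mul_add, ← hsq t ht θ]
    field_simp
  have Pt : ∀ θ, deriv (fun τ => D s X τ θ) t = - (B t θ * D s Y t θ) := by
    intro θ
    rw [comm hs hs0 hX hI hst ht θ, hA t ht θ, hBe t ht θ]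
    linear_combination (-D s (fun t θ => deriv (fun τ => X τ θ) t) t θ) * one t ht θ
  have Qt : ∀ θ, deriv (fun τ => D s Y τ θ) t = B t θ * D s X t θ := by
    intro θ
    rw [comm hs hs0 hY hI hst ht θ, hA t ht θ, hBe t ht θ]
    linear_combination (-D s (fun t θ => deriv (fun τ => Y τ θ) t) t θ) * one t ht θ
  have DP : D s (fun t θ => deriv (fun τ => D s X τ θ) t) t θ
      = - (D s B t θ * D s Y t θ + B t θ * D s (D s Y) t θ) := by
    have h := ((hB.hasθ hI ht θ).fun_mul (sY.hasθ hI ht θ)).fun_neg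
    rw [← funext Pt] at h
    have h' := h.deriv
    show (s t θ)⁻¹ * deriv (fun y => deriv (fun τ => D s X τ y) t) θ = _
    rw [h']
    show _ = -((s t θ)⁻¹ * deriv (B t) θ * _ + _ * ((s t θ)⁻¹ * deriv (D s Y t) θ))
    ring
  have DQ : D s (fun t θ => deriv (fun τ => D s Y τ θ) t) t θ
      = D s B t θ * D s X t θ + B t θ * D s (D s X) t θ := by
    have h := (hB.hasθ hI ht θ).fun_mul (sX.hasθ hI ht θ)
    rw [← funext Qt] at h
    have h' := h.deriv
    show (s t θ)⁻¹ * deriv (fun y => deriv (fun τ => D s Y τ y) t) θ = _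
    rw [h']
    show _ = (s t θ)⁻¹ * deriv (B t) θ * _ + _ * ((s t θ)⁻¹ * deriv (D s X t) θ)
    ring
  have h := (((hs.D hs0 sX hI).hast hI ht θ).fun_neg.fun_mul (sY.hast hI ht θ)).fun_add
    (((hs.D hs0 sY hI).hast hI ht θ).fun_mul (sX.hast hI ht θ))
  refine h.deriv.trans ?_
  rw [comm hs hs0 sX hI hst ht θ, comm hs hs0 sY hI hst ht θ, DP, DQ, Pt, Qt]
  linear_combination D s B t θ * one t ht θ

lemma iter_eq (c : ℝ → ℝ → R2) (F : ℝ → ℝ → ℝ) (t : ℝ) (k : ℕ) :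
    (Ds (c t))^[k] (F t) = (D (fun t => speed (c t)))^[k] F t := by
  induction k with
  | zero => rfl
  | succ k ih => rw [Function.iterate_succ_apply', Function.iterate_succ_apply', ih]; rfl

lemma coord_deriv {f : ℝ → R2} {x : ℝ} (h : DifferentiableAt ℝ f x) (i : Fin 2) :
    (deriv f x) i = deriv (fun y => f y i) x := by
  have h1 := HasFDerivAt.comp_hasDerivAt x
    (EuclideanSpace.proj i : EuclideanSpace ℝ (Fin 2) →L[ℝ] ℝ).hasFDerivAt h.hasDerivAt
  exact h1.deriv.symm

end S10

/-- the variational formula for `D_s^k κ` along a time-dependent curve: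
`∂_t(D_s^k κ) = D_s^{k+1}⟨D_s c_t, n⟩ − Σ_{j=0}^{k} C(k+1,j+1) (D_s^{k−j} κ) D_s^j⟨D_s c_t, v⟩`. -/
theorem statement_10 (I : Set ℝ) (hI : IsOpen I) (hIconn : I.OrdConnected)
    (c : ℝ → ℝ → R2)
    (hc : ContDiffOn ℝ (⊤ : ℕ∞) (fun p : ℝ × ℝ => c p.1 p.2) (I ×ˢ Set.univ))
    (hcim : ∀ t ∈ I, IsImmersion (c t)) :
    ∀ t ∈ I, ∀ (k : ℕ) (θ : ℝ),
      deriv (fun τ => (Ds (c τ))^[k] (curv (c τ)) θ) t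
        = (Ds (c t))^[k + 1]
            (fun x => (⟪Ds (c t) (fun y => deriv (fun τ => c τ y) t) x, normalV (c t) x⟫ : ℝ)) θ
          - ∑ j ∈ Finset.range (k + 1), ((k + 1).choose (j + 1) : ℝ)
              * (Ds (c t))^[k - j] (curv (c t)) θ
              * (Ds (c t))^[j]
                  (fun x =>
                    (⟪Ds (c t) (fun y => deriv (fun τ => c τ y) t) x, tangentV (c t) x⟫ : ℝ)) θ := by
  intro t ht k θ
  set s : ℝ → ℝ → ℝ := fun t => speed (c t) with hsdef
  set X : ℝ → ℝ → ℝ := fun t θ => c t θ 0 with hXdef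
  set Y : ℝ → ℝ → ℝ := fun t θ => c t θ 1 with hYdef
  have hX : S10.Sm I X := contDiffOn_euclidean.1 hc 0
  have hY : S10.Sm I Y := contDiffOn_euclidean.1 hc 1
  have dcθ : ∀ t ∈ I, ∀ θ, DifferentiableAt ℝ (c t) θ := fun t ht θ =>
    (hcim t ht).1.1.differentiable (by simp) θ
  have dct : ∀ t ∈ I, ∀ θ, DifferentiableAt ℝ (fun τ => c τ θ) t := fun t ht θ => by
    refine differentiableAt_euclidean.2 fun i => ?_
    fin_cases i
    · exact (hX.hast hI ht θ).differentiableAt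
    · exact (hY.hast hI ht θ).differentiableAt
  have c0 : ∀ t ∈ I, ∀ θ, deriv (c t) θ 0 = deriv (X t) θ := fun t ht θ =>
    S10.coord_deriv (dcθ t ht θ) 0
  have c1 : ∀ t ∈ I, ∀ θ, deriv (c t) θ 1 = deriv (Y t) θ := fun t ht θ =>
    S10.coord_deriv (dcθ t ht θ) 1
  have hs0 : ∀ t ∈ I, ∀ θ, s t θ ≠ 0 := fun t ht θ => norm_ne_zero_iff.2 ((hcim t ht).2 θ)
  have hsq : ∀ t ∈ I, ∀ θ, s t θ ^ 2 = deriv (X t) θ ^ 2 + deriv (Y t) θ ^ 2 := by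
    intro t ht θ
    rw [← c0 t ht, ← c1 t ht]
    simp [hsdef, speed, EuclideanSpace.norm_sq_eq]
  have hs : S10.Sm I s := by
    have h1 : ContDiffOn ℝ (⊤ : ℕ∞) (fun p : ℝ × ℝ =>
        √(deriv (X p.1) p.2 ^ 2 + deriv (Y p.1) p.2 ^ 2)) (I ×ˢ Set.univ) := by
      refine ContDiffOn.sqrt ((ContDiffOn.pow (hX.dθ hI) 2).add (ContDiffOn.pow (hY.dθ hI) 2)) ?_
      intro p hp
      have := hsq p.1 hp.1 p.2
      have h0 := hs0 p.1 hp.1 p.2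
      rw [← this]; positivity
    refine h1.congr fun p hp => ?_
    rw [← hsq p.1 hp.1 p.2, Real.sqrt_sq (show 0 ≤ s p.1 p.2 from norm_nonneg _)]
  have v0 : ∀ t ∈ I, ∀ θ, tangentV (c t) θ 0 = S10.D s X t θ := fun t ht θ => by
    simp [tangentV, S10.D, hsdef, c0 t ht]
  have v1 : ∀ t ∈ I, ∀ θ, tangentV (c t) θ 1 = S10.D s Y t θ := fun t ht θ => by
    simp [tangentV, S10.D, hsdef, c1 t ht]
  have sX := hs.D hs0 hX hI
  have sY := hs.D hs0 hY hI
  have dv : ∀ t ∈ I, ∀ θ, DifferentiableAt ℝ (tangentV (c t)) θ := fun t ht θ => by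
    refine differentiableAt_euclidean.2 fun i => ?_
    fin_cases i
    · exact (sX.hasθ hI ht θ).differentiableAt.congr_of_eventuallyEq
        (Filter.Eventually.of_forall fun y => v0 t ht y)
    · exact (sY.hasθ hI ht θ).differentiableAt.congr_of_eventuallyEq
        (Filter.Eventually.of_forall fun y => v1 t ht y)
  have w0 : ∀ t ∈ I, ∀ θ, Ds (c t) (tangentV (c t)) θ 0 = S10.D s (S10.D s X) t θ :=
    fun t ht θ => by
    have := S10.coord_deriv (dv t ht θ) 0
    rw [show (fun y => tangentV (c t) y 0) = S10.D s X t from funext (v0 t ht)] at this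
    rw [S10.D, ← this]; rfl
  have w1 : ∀ t ∈ I, ∀ θ, Ds (c t) (tangentV (c t)) θ 1 = S10.D s (S10.D s Y) t θ :=
    fun t ht θ => by
    have := S10.coord_deriv (dv t ht θ) 1
    rw [show (fun y => tangentV (c t) y 1) = S10.D s Y t from funext (v1 t ht)] at this
    rw [S10.D, ← this]; rfl
  have dh : ∀ t ∈ I, ∀ θ, DifferentiableAt ℝ (fun y => deriv (fun τ => c τ y) t) θ :=
    fun t ht θ => by
    refine differentiableAt_euclidean.2 fun i => ?_
    fin_cases i
    · exact ((hX.dt hI).hasθ hI ht θ).differentiableAt.congr_of_eventuallyEq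
        (Filter.Eventually.of_forall fun y => S10.coord_deriv (dct t ht y) 0)
    · exact ((hY.dt hI).hasθ hI ht θ).differentiableAt.congr_of_eventuallyEq
        (Filter.Eventually.of_forall fun y => S10.coord_deriv (dct t ht y) 1)
  have h0 : ∀ t ∈ I, ∀ θ, Ds (c t) (fun y => deriv (fun τ => c τ y) t) θ 0
      = S10.D s (fun t θ => deriv (fun τ => X τ θ) t) t θ := fun t ht θ => by
    have := S10.coord_deriv (dh t ht θ) 0
    rw [show (fun y => deriv (fun τ => c τ y) t 0) = fun y => deriv (fun τ => X τ y) t from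
      funext fun y => S10.coord_deriv (dct t ht y) 0] at this
    rw [S10.D, ← this]; rfl
  have h1 : ∀ t ∈ I, ∀ θ, Ds (c t) (fun y => deriv (fun τ => c τ y) t) θ 1
      = S10.D s (fun t θ => deriv (fun τ => Y τ θ) t) t θ := fun t ht θ => by
    have := S10.coord_deriv (dh t ht θ) 1
    rw [show (fun y => deriv (fun τ => c τ y) t 1) = fun y => deriv (fun τ => Y τ y) t from
      funext fun y => S10.coord_deriv (dct t ht y) 1] at this
    rw [S10.D, ← this]; rfl
  have inn : ∀ a b : R2, ⟪a, b⟫ = a 0 * b 0 + a 1 * b 1 := fun a b => by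
    simp [PiLp.inner_apply, Fin.sum_univ_two]; ring
  have innJ : ∀ a b : R2, ⟪a, Jrot b⟫ = - a 0 * b 1 + a 1 * b 0 := fun a b => by
    rw [inn]; simp [Jrot]
  set A : ℝ → ℝ → ℝ := fun t x =>
    ⟪Ds (c t) (fun y => deriv (fun τ => c τ y) t) x, tangentV (c t) x⟫ with hAdef
  set B : ℝ → ℝ → ℝ := fun t x =>
    ⟪Ds (c t) (fun y => deriv (fun τ => c τ y) t) x, normalV (c t) x⟫ with hBdef
  set K : ℝ → ℝ → ℝ := fun t => curv (c t) with hKdef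
  have hA : ∀ t ∈ I, ∀ θ, A t θ
      = S10.D s (fun t θ => deriv (fun τ => X τ θ) t) t θ * S10.D s X t θ
      + S10.D s (fun t θ => deriv (fun τ => Y τ θ) t) t θ * S10.D s Y t θ := fun t ht θ => by
    rw [← h0 t ht, ← h1 t ht, ← v0 t ht, ← v1 t ht]; exact inn _ _
  have hB : ∀ t ∈ I, ∀ θ, B t θ
      = - S10.D s (fun t θ => deriv (fun τ => X τ θ) t) t θ * S10.D s Y t θ
      + S10.D s (fun t θ => deriv (fun τ => Y τ θ) t) t θ * S10.D s X t θ := fun t ht θ => by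
    rw [← h0 t ht, ← h1 t ht, ← v0 t ht, ← v1 t ht]; exact innJ _ _
  have hK : ∀ t ∈ I, ∀ θ, K t θ
      = - S10.D s (S10.D s X) t θ * S10.D s Y t θ
      + S10.D s (S10.D s Y) t θ * S10.D s X t θ := fun t ht θ => by
    rw [← w0 t ht, ← w1 t ht, ← v0 t ht, ← v1 t ht]; exact innJ _ _
  have hXt := hs.D hs0 (hX.dt hI) hI
  have hYt := hs.D hs0 (hY.dt hI) hI
  have smA : S10.Sm I A := ((ContDiffOn.mul hXt sX).add (ContDiffOn.mul hYt sY)).congr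
    fun p hp => hA p.1 hp.1 p.2
  have smB : S10.Sm I B :=
    ((ContDiffOn.mul (ContDiffOn.neg hXt) sY).add (ContDiffOn.mul hYt sX)).congr
    fun p hp => hB p.1 hp.1 p.2
  have smK : S10.Sm I K :=
    ((ContDiffOn.mul (ContDiffOn.neg (hs.D hs0 sX hI)) sY).add
      (ContDiffOn.mul (hs.D hs0 sY hI) sX)).congr
    fun p hp => hK p.1 hp.1 p.2
  obtain ⟨b1, b2⟩ := S10.base hs hs0 hX hY hI hsq smB hA hB
  have b3 : ∀ t ∈ I, ∀ θ, deriv (fun τ => K τ θ) t = S10.D s B t θ - A t θ * K t θ := by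
    intro t ht θ
    rw [hK t ht θ, ← b2 t ht θ]
    refine Filter.EventuallyEq.deriv_eq ?_
    filter_upwards [hI.mem_nhds ht] with τ hτ using hK τ hτ θ
  have key := S10.main hs hs0 smK smA smB hI b1 b3 ht k θ
  have it := S10.iter_eq c
  have g1 : (fun τ => (Ds (c τ))^[k] (curv (c τ)) θ) = fun τ => (S10.D s)^[k] K τ θ :=
    funext fun τ => congrFun (it K τ k) θ
  rw [g1, key]
  refine congrArg₂ _ (congrFun (it B t (k + 1)) θ).symm (Finset.sum_congr rfl fun j _ => ?_)
  rw [← it K t, ← it A t]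
end
end

section
/- Let n ≥ 1 and a_0, …, a_n ≥ 0 be constants, and let G be the Sobolev metric G_c(h,k) = ∫_{S¹} Σ_{j=0}^n a_j ⟨D_s^j h, D_s^j k⟩ |c'| dθ. Then for all smooth immersions c : S¹ → ℝ² and all smooth h, m : S¹ → ℝ² (with c + t·m an immersion for all sufficiently small t), the first variation of the metric is given by: (d/dt)|_{t=0} G_{c+tm}(h,h) = ∫_{S¹} ⟨ −2⟨L_c h, D_s h⟩·v − a_0·⟨h,h⟩·κ·n + Σ_{k=1}^n Σ_{j=1}^{2k−1} (−1)^{k+j} a_k ⟨D_s^{2k−j} h, D_s^j h⟩·κ·n , m ⟩ |c'| dθ, where L_c h = Σ_{k=0}^n (−1)^k a_k D_s^{2k} h. -/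
noncomputable section
open Real MeasureTheory intervalIntegral
open scoped RealInnerProductSpace

/-- The Sobolev metric `G_c(h,k) = ∫ Σ_{j=0}^n a_j ⟨D_s^j h, D_s^j k⟩ |c'| dθ`. -/
def sobolevG (a : ℕ → ℝ) (n : ℕ) (c h k : ℝ → R2) : ℝ :=
  ∫ θ in (0:ℝ)..(2 * π),
    (∑ j ∈ Finset.range (n + 1),
      a j * (⟪(Ds c)^[j] h θ, (Ds c)^[j] k θ⟫ : ℝ)) * speed c θ

/-- The operator `L_c h = Σ_{k=0}^n (−1)^k a_k D_s^{2k} h` associated to the metric. -/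
def Lop (a : ℕ → ℝ) (n : ℕ) (c h : ℝ → R2) (θ : ℝ) : R2 :=
  ∑ k ∈ Finset.range (n + 1), ((-1 : ℝ) ^ k * a k) • (Ds c)^[2 * k] h θ

namespace FirstVar

theorem smoothLoop_deriv {E : Type*} [NormedAddCommGroup E] [NormedSpace ℝ E] {f : ℝ → E}
    (hf : SmoothLoop f) : SmoothLoop (deriv f) := by
  refine ⟨?_, fun x => ?_⟩
  · exact (contDiff_infty_iff_deriv.1 hf.1).2
  · have h : (fun y => f (y + 2 * π)) = f := funext hf.2
    rw [← deriv_comp_add_const, h]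

theorem SL.diff {E : Type*} [NormedAddCommGroup E] [NormedSpace ℝ E] {f : ℝ → E}
    (hf : SmoothLoop f) (x : ℝ) : DifferentiableAt ℝ f x :=
  (hf.1.differentiable (by simp)) x

theorem SL.cont {E : Type*} [NormedAddCommGroup E] [NormedSpace ℝ E] {f : ℝ → E}
    (hf : SmoothLoop f) : Continuous f := hf.1.continuous

theorem SL.add {E : Type*} [NormedAddCommGroup E] [NormedSpace ℝ E] {f g : ℝ → E}
    (hf : SmoothLoop f) (hg : SmoothLoop g) : SmoothLoop (fun x => f x + g x) :=
  ⟨hf.1.add hg.1, fun x => by simp only [hf.2 x, hg.2 x]⟩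

theorem SL.sub {E : Type*} [NormedAddCommGroup E] [NormedSpace ℝ E] {f g : ℝ → E}
    (hf : SmoothLoop f) (hg : SmoothLoop g) : SmoothLoop (fun x => f x - g x) :=
  ⟨hf.1.sub hg.1, fun x => by simp only [hf.2 x, hg.2 x]⟩

theorem SL.smul {E : Type*} [NormedAddCommGroup E] [NormedSpace ℝ E] {f : ℝ → ℝ} {g : ℝ → E}
    (hf : SmoothLoop f) (hg : SmoothLoop g) : SmoothLoop (fun x => f x • g x) :=
  ⟨hf.1.smul hg.1, fun x => by simp only [hf.2 x, hg.2 x]⟩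

theorem SL.mul {f g : ℝ → ℝ}
    (hf : SmoothLoop f) (hg : SmoothLoop g) : SmoothLoop (fun x => f x * g x) :=
  ⟨hf.1.mul hg.1, fun x => by simp only [hf.2 x, hg.2 x]⟩

theorem SL.const {E : Type*} [NormedAddCommGroup E] [NormedSpace ℝ E] (e : E) :
    SmoothLoop (fun _ : ℝ => e) := ⟨contDiff_const, fun _ => rfl⟩

theorem SL.inner {f g : ℝ → R2}
    (hf : SmoothLoop f) (hg : SmoothLoop g) : SmoothLoop (fun x => (⟪f x, g x⟫ : ℝ)) :=
  ⟨hf.1.inner ℝ hg.1, fun x => by simp only [hf.2 x, hg.2 x]⟩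

theorem SL.sum {E : Type*} [NormedAddCommGroup E] [NormedSpace ℝ E] {s : Finset ℕ}
    {f : ℕ → ℝ → E} (hf : ∀ i, SmoothLoop (f i)) : SmoothLoop (fun x => ∑ i ∈ s, f i x) :=
  ⟨ContDiff.sum fun i _ => (hf i).1, fun x => by simp only [(hf _).2 x]⟩

theorem SL.speed {c : ℝ → R2} (hc : IsImmersion c) : SmoothLoop (speed c) := by
  have h := smoothLoop_deriv hc.1
  exact ⟨h.1.norm ℝ hc.2, fun x => by simp only [_root_.speed, h.2 x]⟩

theorem speed_pos {c : ℝ → R2} (hc : IsImmersion c) (x : ℝ) : 0 < speed c x :=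
  norm_pos_iff.2 (hc.2 x)

theorem SL.speedInv {c : ℝ → R2} (hc : IsImmersion c) : SmoothLoop (fun x => (_root_.speed c x)⁻¹) := by
  have h := SL.speed hc
  exact ⟨h.1.inv fun x => (speed_pos hc x).ne', fun x => by simp only [h.2 x]⟩

theorem SL.Ds {E : Type*} [NormedAddCommGroup E] [NormedSpace ℝ E] {c : ℝ → R2} {f : ℝ → E}
    (hc : IsImmersion c) (hf : SmoothLoop f) : SmoothLoop (_root_.Ds c f) :=
  SL.smul (SL.speedInv hc) (smoothLoop_deriv hf)

theorem SL.DsIter {E : Type*} [NormedAddCommGroup E] [NormedSpace ℝ E] {c : ℝ → R2} {f : ℝ → E}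
    (hc : IsImmersion c) (hf : SmoothLoop f) (k : ℕ) : SmoothLoop ((_root_.Ds c)^[k] f) := by
  induction k with
  | zero => exact hf
  | succ k ih => rw [Function.iterate_succ_apply']; exact SL.Ds hc ih

theorem SL.tangent {c : ℝ → R2} (hc : IsImmersion c) : SmoothLoop (tangentV c) :=
  SL.smul (SL.speedInv hc) (smoothLoop_deriv hc.1)

theorem SL.int {f : ℝ → ℝ} (hf : SmoothLoop f) :
    IntervalIntegrable f volume 0 (2 * π) := (SL.cont hf).intervalIntegrable _ _

/-- The integral of a derivative of a loop vanishes. -/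
theorem integral_deriv_zero {f : ℝ → ℝ} (hf : SmoothLoop f) :
    ∫ x in (0:ℝ)..(2 * π), deriv f x = 0 := by
  rw [integral_deriv_eq_sub (fun x _ => SL.diff hf x) (SL.int (smoothLoop_deriv hf))]
  have := hf.2 0
  rw [zero_add] at this
  rw [this, sub_self]

/-- Leibniz rule for `D_s`. -/
theorem Ds_inner {c f g : ℝ → R2} (hf : SmoothLoop f) (hg : SmoothLoop g) (x : ℝ) :
    Ds c (fun y => (⟪f y, g y⟫ : ℝ)) x = ⟪Ds c f x, g x⟫ + ⟪f x, Ds c g x⟫ := by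
  simp only [Ds]
  rw [deriv_inner_apply (𝕜 := ℝ) (SL.diff hf x) (SL.diff hg x)]
  simp only [real_inner_smul_left, real_inner_smul_right, smul_eq_mul]
  ring

theorem Ds_smul {c g : ℝ → R2} {f : ℝ → ℝ} (hf : SmoothLoop f) (hg : SmoothLoop g) (x : ℝ) :
    Ds c (fun y => f y • g y) x = Ds c f x • g x + f x • Ds c g x := by
  simp only [Ds]
  rw [deriv_fun_smul (SL.diff hf x) (SL.diff hg x)]
  module

theorem Ds_mul_speed {c : ℝ → R2} (hc : IsImmersion c) (f : ℝ → ℝ) (x : ℝ) :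
    Ds c f x * speed c x = deriv f x := by
  have := (speed_pos hc x).ne'
  simp only [Ds, smul_eq_mul]; field_simp

/-- Integration by parts in arc length. -/
theorem ibp {c f g : ℝ → R2} (hc : IsImmersion c) (hf : SmoothLoop f) (hg : SmoothLoop g) :
    ∫ x in (0:ℝ)..(2 * π), (⟪Ds c f x, g x⟫ : ℝ) * speed c x
      = - ∫ x in (0:ℝ)..(2 * π), (⟪f x, Ds c g x⟫ : ℝ) * speed c x := by
  rw [eq_neg_iff_add_eq_zero, ← intervalIntegral.integral_add]
  · refine Eq.trans ?_ (integral_deriv_zero (SL.inner hf hg))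
    congr 1; ext x
    rw [← add_mul, ← Ds_inner hf hg, Ds_mul_speed hc]
  · exact SL.int (SL.mul (SL.inner (SL.Ds hc hf) hg) (SL.speed hc))
  · exact SL.int (SL.mul (SL.inner hf (SL.Ds hc hg)) (SL.speed hc))

theorem inner_R2 (x y : R2) : (⟪x, y⟫ : ℝ) = x 0 * y 0 + x 1 * y 1 := by
  simp [PiLp.inner_apply, Fin.sum_univ_two, mul_comm]

theorem Jrot_zero (w : R2) : Jrot w 0 = -(w 1) := by simp [Jrot]
theorem Jrot_one (w : R2) : Jrot w 1 = w 0 := by simp [Jrot]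

theorem tangent_unit {c : ℝ → R2} (hc : IsImmersion c) (x : ℝ) :
    (⟪tangentV c x, tangentV c x⟫ : ℝ) = 1 := by
  have h := (speed_pos hc x).ne'
  rw [real_inner_self_eq_norm_sq, tangentV, norm_smul, ← speed, norm_inv, Real.norm_eq_abs,
    abs_of_pos (speed_pos hc x), inv_mul_cancel₀ h, one_pow]

/-- Frenet equation. -/
theorem Ds_tangent {c : ℝ → R2} (hc : IsImmersion c) (x : ℝ) :
    Ds c (tangentV c) x = curv c x • normalV c x := by
  have h1 := tangent_unit hc x
  have h2 : (⟪Ds c (tangentV c) x, tangentV c x⟫ : ℝ) = 0 := by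
    have := Ds_inner (c := c) (SL.tangent hc) (SL.tangent hc) x
    have h3 : (fun y => (⟪tangentV c y, tangentV c y⟫ : ℝ)) = fun _ => 1 :=
      funext (tangent_unit hc)
    rw [h3, real_inner_comm] at this
    have h4 : Ds c (fun _ : ℝ => (1:ℝ)) x = 0 := by simp [Ds]
    rw [h4] at this
    rw [real_inner_comm]
    linarith
  rw [inner_R2] at h1 h2
  ext i
  simp only [curv, normalV, inner_R2, PiLp.smul_apply, smul_eq_mul]
  fin_cases i
  · simp only [Fin.zero_eta, Jrot_zero, Jrot_one]
    linear_combination (-Ds c (tangentV c) x 0) * h1 + tangentV c x 0 * h2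
  · simp only [Fin.mk_one, Jrot_zero, Jrot_one]
    linear_combination (-Ds c (tangentV c) x 1) * h1 + tangentV c x 1 * h2

/-- `⟨D_s m, v⟩`. -/
def pfun (c m : ℝ → R2) (θ : ℝ) : ℝ := ⟪Ds c m θ, tangentV c θ⟫

/-- Variation of `D_s^k h` in direction `m`. -/
def Kvar (c h m : ℝ → R2) : ℕ → ℝ → R2
  | 0 => fun _ => 0
  | k + 1 => fun θ => Ds c (Kvar c h m k) θ - pfun c m θ • (Ds c)^[k + 1] h θ

theorem SL.pfun {c m : ℝ → R2} (hc : IsImmersion c) (hm : SmoothLoop m) :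
    SmoothLoop (pfun c m) := SL.inner (SL.Ds hc hm) (SL.tangent hc)

theorem SL.Kvar {c h m : ℝ → R2} (hc : IsImmersion c) (hh : SmoothLoop h) (hm : SmoothLoop m)
    (k : ℕ) : SmoothLoop (Kvar c h m k) := by
  induction k with
  | zero => exact SL.const 0
  | succ k ih => exact SL.sub (SL.Ds hc ih) (SL.smul (SL.pfun hc hm) (SL.DsIter hc hh _))

theorem Kvar_integral {c h m : ℝ → R2} (hc : IsImmersion c) (hh : SmoothLoop h)
    (hm : SmoothLoop m) (k : ℕ) (g : ℝ → R2) (hg : SmoothLoop g) :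
    ∫ x in (0:ℝ)..(2 * π), (⟪Kvar c h m k x, g x⟫ : ℝ) * speed c x
      = - ∫ x in (0:ℝ)..(2 * π), (pfun c m x * ∑ i ∈ Finset.range k,
          (-1 : ℝ) ^ i * (⟪(Ds c)^[k - i] h x, (Ds c)^[i] g x⟫ : ℝ)) * speed c x := by
  induction k generalizing g with
  | zero => simp [Kvar]
  | succ k ih =>
    have hK := SL.Kvar hc hh hm k
    have hs := SL.speed hc
    have hp := SL.pfun hc hm
    have e1 : ∀ x, (⟪Kvar c h m (k + 1) x, g x⟫ : ℝ) * speed c x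
        = (⟪Ds c (Kvar c h m k) x, g x⟫ : ℝ) * speed c x
          - (pfun c m x * (⟪(Ds c)^[k + 1] h x, g x⟫ : ℝ)) * speed c x := by
      intro x
      simp only [Kvar, inner_sub_left, real_inner_smul_left]; ring
    simp only [e1]
    have i1 := SL.int (SL.mul (SL.inner (SL.Ds hc hK) hg) hs)
    have i2 := SL.int (SL.mul (SL.mul hp (SL.inner (SL.DsIter hc hh (k + 1)) hg)) hs)
    have i3 : SmoothLoop fun x => (pfun c m x * ∑ i ∈ Finset.range k,
          (-1 : ℝ) ^ i * (⟪(Ds c)^[k - i] h x, (Ds c)^[i] (Ds c g) x⟫ : ℝ)) * speed c x :=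
      SL.mul (SL.mul hp (SL.sum fun i => SL.mul (SL.const _)
        (SL.inner (SL.DsIter hc hh _) (SL.DsIter hc (SL.Ds hc hg) _)))) hs
    rw [integral_sub i1 i2, ibp hc hK hg, ih _ (SL.Ds hc hg), neg_neg,
      ← integral_sub (SL.int i3) i2, ← intervalIntegral.integral_neg]
    congr 1; ext x
    rw [Finset.sum_range_succ']
    have e2 : ∑ i ∈ Finset.range k, (-1 : ℝ) ^ (i + 1) *
          (⟪(Ds c)^[k + 1 - (i + 1)] h x, (Ds c)^[i + 1] g x⟫ : ℝ)
        = - ∑ i ∈ Finset.range k,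
          (-1 : ℝ) ^ i * (⟪(Ds c)^[k - i] h x, (Ds c)^[i] (Ds c g) x⟫ : ℝ) := by
      rw [← Finset.sum_neg_distrib]
      refine Finset.sum_congr rfl fun i _ => ?_
      rw [Nat.add_sub_add_right, Function.iterate_succ_apply, pow_succ]; ring
    rw [e2]
    simp only [pow_zero, Nat.sub_zero, Function.iterate_zero, id]
    ring

/-- The density multiplying `⟨D_s m, v⟩`. -/
def Wk (c h : ℝ → R2) (k : ℕ) (x : ℝ) : ℝ :=
  (⟪(Ds c)^[k] h x, (Ds c)^[k] h x⟫ : ℝ) - 2 * ∑ i ∈ Finset.range k,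
    (-1 : ℝ) ^ i * (⟪(Ds c)^[k - i] h x, (Ds c)^[k + i] h x⟫ : ℝ)

theorem SL.Wk {c h : ℝ → R2} (hc : IsImmersion c) (hh : SmoothLoop h) (k : ℕ) :
    SmoothLoop (Wk c h k) :=
  SL.sub (SL.inner (SL.DsIter hc hh _) (SL.DsIter hc hh _)) (SL.mul (SL.const _) (SL.sum fun _ =>
    SL.mul (SL.const _) (SL.inner (SL.DsIter hc hh _) (SL.DsIter hc hh _))))

theorem Ds_iter_inner {c h : ℝ → R2} (hc : IsImmersion c) (hh : SmoothLoop h) (i j : ℕ) (x : ℝ) :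
    Ds c (fun y => (⟪(Ds c)^[i] h y, (Ds c)^[j] h y⟫ : ℝ)) x
      = ⟪(Ds c)^[i + 1] h x, (Ds c)^[j] h x⟫ + ⟪(Ds c)^[i] h x, (Ds c)^[j + 1] h x⟫ := by
  rw [Ds_inner (SL.DsIter hc hh _) (SL.DsIter hc hh _), Function.iterate_succ_apply',
    Function.iterate_succ_apply']

theorem Ds_Wk {c h : ℝ → R2} (hc : IsImmersion c) (hh : SmoothLoop h) (k : ℕ) (x : ℝ) :
    Ds c (Wk c h k) x = 2 * ((-1 : ℝ) ^ k * (⟪(Ds c)^[2 * k] h x, Ds c h x⟫ : ℝ)) := by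
  have hin : ∀ i j, SmoothLoop (fun y => (⟪(Ds c)^[i] h y, (Ds c)^[j] h y⟫ : ℝ)) := fun i j =>
    SL.inner (SL.DsIter hc hh _) (SL.DsIter hc hh _)
  have e0 : Ds c (Wk c h k) x
      = Ds c (fun y => (⟪(Ds c)^[k] h y, (Ds c)^[k] h y⟫ : ℝ)) x
        - 2 * ∑ i ∈ Finset.range k, (-1 : ℝ) ^ i *
          Ds c (fun y => (⟪(Ds c)^[k - i] h y, (Ds c)^[k + i] h y⟫ : ℝ)) x := by
    simp only [Ds]
    unfold Wk
    rw [deriv_fun_sub (SL.diff (hin k k) x), deriv_const_mul, deriv_fun_sum]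
    · simp only [smul_eq_mul, mul_sub]
      congr 1
      rw [← mul_assoc, mul_comm (speed c x)⁻¹ 2, mul_assoc, Finset.mul_sum]
      congr 1
      refine Finset.sum_congr rfl fun i _ => ?_
      rw [deriv_const_mul _ (SL.diff (hin _ _) x)]
      ring
    · exact fun i _ => SL.diff (SL.mul (SL.const _) (hin _ _)) x
    · exact SL.diff (SL.sum fun i => (SL.mul (SL.const _) (hin _ _))) x
    · exact SL.diff (SL.mul (SL.const _) (SL.sum fun i => (SL.mul (SL.const _) (hin _ _)))) x
  rw [e0]
  simp only [Ds_iter_inner hc hh]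
  have e1 : ∀ r ≤ k, ∑ i ∈ Finset.range r, (-1 : ℝ) ^ i *
      ((⟪(Ds c)^[k - i + 1] h x, (Ds c)^[k + i] h x⟫ : ℝ)
        + ⟪(Ds c)^[k - i] h x, (Ds c)^[k + i + 1] h x⟫)
      = (⟪(Ds c)^[k + 1] h x, (Ds c)^[k] h x⟫ : ℝ)
        - (-1 : ℝ) ^ r * ⟪(Ds c)^[k - r + 1] h x, (Ds c)^[k + r] h x⟫ := by
    intro r hr
    induction r with
    | zero => simp
    | succ r ih =>
      rw [Finset.sum_range_succ, ih (by omega)]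
      have : k - (r + 1) + 1 = k - r := by omega
      rw [this, ← add_assoc k r 1]
      ring
  rw [e1 k le_rfl, Nat.sub_self, zero_add, ← two_mul,
    real_inner_comm ((Ds c)^[k + 1] h x) ((Ds c)^[k] h x),
    real_inner_comm ((Ds c)^[2 * k] h x) ]
  simp only [Function.iterate_one]
  ring

theorem Wk_eq_sum (c h : ℝ → R2) (k : ℕ) (hk : 1 ≤ k) (x : ℝ) :
    ∑ j ∈ Finset.Icc 1 (2 * k - 1),
      (-1 : ℝ) ^ (k + j) * (⟪(Ds c)^[2 * k - j] h x, (Ds c)^[j] h x⟫ : ℝ) = - Wk c h k x := by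
  have key : ∀ r, r + 1 ≤ k → ∑ j ∈ Finset.Icc (k - r) (k + r),
      (-1 : ℝ) ^ (k + j) * (⟪(Ds c)^[2 * k - j] h x, (Ds c)^[j] h x⟫ : ℝ)
      = - (⟪(Ds c)^[k] h x, (Ds c)^[k] h x⟫ : ℝ) + 2 * ∑ i ∈ Finset.range (r + 1),
    (-1 : ℝ) ^ i * (⟪(Ds c)^[k - i] h x, (Ds c)^[k + i] h x⟫ : ℝ) := by
    intro r hr
    induction r with
    | zero =>
      simp [two_mul, ← mul_pow, pow_add]
      try ring
    | succ r ih =>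
      have i1 : Finset.Icc (k - (r + 1)) (k + (r + 1))
          = insert (k - (r + 1)) (insert (k + (r + 1)) (Finset.Icc (k - r) (k + r))) := by
        ext j; simp only [Finset.mem_Icc, Finset.mem_insert]; omega
      rw [i1, Finset.sum_insert (by simp only [Finset.mem_Icc, Finset.mem_insert]; omega),
        Finset.sum_insert (by simp only [Finset.mem_Icc]; omega), ih (by omega),
        Finset.sum_range_succ _ (r + 1)]
      have a1 : 2 * k - (k - (r + 1)) = k + (r + 1) := by omega
      have a2 : 2 * k - (k + (r + 1)) = k - (r + 1) := by omega
      have s1 : (-1 : ℝ) ^ (k + (k + (r + 1))) = (-1) ^ (r + 1) := by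
        rw [← add_assoc, pow_add, ← two_mul, pow_mul]; simp
      have s2 : (-1 : ℝ) ^ (k + (k - (r + 1))) = (-1) ^ (r + 1) := by
        have : k + (k - (r + 1)) = 2 * (k - (r + 1)) + (r + 1) := by omega
        rw [this, pow_add, pow_mul]; simp
      rw [a1, a2, s1, s2, real_inner_comm ((Ds c)^[k - (r + 1)] h x) ((Ds c)^[k + (r + 1)] h x)]
      ring
  have := key (k - 1) (by omega)
  have b1 : k - (k - 1) = 1 := by omega
  have b2 : k + (k - 1) = 2 * k - 1 := by omega
  have b3 : k - 1 + 1 = k := by omega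
  rw [b1, b2, b3] at this
  rw [this, Wk]; ring

/-- The varied curve. -/
def ct (c m : ℝ → R2) (t : ℝ) : ℝ → R2 := fun x => c x + t • m x

theorem ct_zero (c m : ℝ → R2) : ct c m 0 = c := by funext x; simp [ct]

/-- The slab `|t| < ε`. -/
def slab (ε : ℝ) : Set (ℝ × ℝ) := {p | |p.1| < ε}

theorem isOpen_slab (ε : ℝ) : IsOpen (slab ε) :=
  isOpen_lt (by fun_prop) (by fun_prop)

theorem hasDerivAt_snd {E : Type*} [NormedAddCommGroup E] [NormedSpace ℝ E] {F : ℝ × ℝ → E}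
    {t x : ℝ} (hF : DifferentiableAt ℝ F (t, x)) :
    HasDerivAt (fun y => F (t, y)) (fderiv ℝ F (t, x) (0, 1)) x :=
  hF.hasFDerivAt.comp_hasDerivAt x ((hasDerivAt_const x t).prodMk (hasDerivAt_id x))

theorem hasDerivAt_fst {E : Type*} [NormedAddCommGroup E] [NormedSpace ℝ E] {F : ℝ × ℝ → E}
    {t x : ℝ} (hF : DifferentiableAt ℝ F (t, x)) :
    HasDerivAt (fun s => F (s, x)) (fderiv ℝ F (t, x) (1, 0)) t :=
  hF.hasFDerivAt.comp_hasDerivAt t ((hasDerivAt_id t).prodMk (hasDerivAt_const t x))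

theorem hasDerivAt_swap {E : Type*} [NormedAddCommGroup E] [NormedSpace ℝ E] {F : ℝ × ℝ → E}
    {t x : ℝ} (hF : ContDiffAt ℝ (⊤ : ℕ∞) F (t, x)) :
    HasDerivAt (fun s => fderiv ℝ F (s, x) (0, 1))
      (deriv (fun y => fderiv ℝ F (t, y) (1, 0)) x) t := by
  have h22 : (2 : WithTop ℕ∞) ≤ ((⊤ : ℕ∞) : WithTop ℕ∞) :=
    WithTop.coe_le_coe.2 (le_top : (2 : ℕ∞) ≤ ⊤)
  have hs : IsSymmSndFDerivAt ℝ F (t, x) := hF.isSymmSndFDerivAt (by simpa using h22)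
  have hd : DifferentiableAt ℝ (fderiv ℝ F) (t, x) :=
    (hF.fderiv_right (m := 1) (by rw [one_add_one_eq_two]; exact h22)).differentiableAt (by simp)
  have h1 := ((ContinuousLinearMap.apply ℝ E ((0 : ℝ), (1 : ℝ))).hasFDerivAt.comp_hasDerivAt t
    (hasDerivAt_fst hd))
  have h2 := ((ContinuousLinearMap.apply ℝ E ((1 : ℝ), (0 : ℝ))).hasFDerivAt.comp_hasDerivAt x
    (hasDerivAt_snd hd))
  have h3 : deriv (fun y => fderiv ℝ F (t, y) (1, 0)) x
      = fderiv ℝ (fderiv ℝ F) (t, x) (0, 1) (1, 0) := h2.deriv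
  rw [h3, ← hs]
  exact h1

theorem speed_contDiffOn {c m : ℝ → R2} {ε : ℝ} (hc : SmoothLoop c) (hm : SmoothLoop m)
    (hi : ∀ t : ℝ, |t| < ε → IsImmersion (ct c m t)) :
    ContDiffOn ℝ (⊤ : ℕ∞) (fun p : ℝ × ℝ => speed (ct c m p.1) p.2) (slab ε) := by
  have h : ∀ p : ℝ × ℝ, deriv (ct c m p.1) p.2 = deriv c p.2 + p.1 • deriv m p.2 := fun p =>
    ((SL.diff hc p.2).hasDerivAt.add ((SL.diff hm p.2).hasDerivAt.const_smul p.1)).deriv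
  have h0 : ContDiff ℝ (⊤ : ℕ∞) (fun p : ℝ × ℝ => deriv c p.2 + p.1 • deriv m p.2) :=
    ((smoothLoop_deriv hc).1.comp contDiff_snd).add
      (contDiff_fst.smul ((smoothLoop_deriv hm).1.comp contDiff_snd))
  simp only [speed, h]
  refine h0.contDiffOn.norm ℝ fun p hp => ?_
  rw [← h]
  exact (hi p.1 hp).2 p.2

/-- `D_s^j h` along the varied curves, as a function of two variables. -/
def HH (c h m : ℝ → R2) (j : ℕ) (p : ℝ × ℝ) : R2 := (Ds (ct c m p.1))^[j] h p.2

theorem HH_succ {c h m : ℝ → R2} {j : ℕ} {t x : ℝ}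
    (hd : DifferentiableAt ℝ (HH c h m j) (t, x)) :
    HH c h m (j + 1) (t, x)
      = (speed (ct c m t) x)⁻¹ • fderiv ℝ (HH c h m j) (t, x) (0, 1) := by
  rw [← (hasDerivAt_snd hd).deriv]
  simp only [HH, Function.iterate_succ_apply', Ds]

theorem HH_contDiffOn {c h m : ℝ → R2} {ε : ℝ} (hc : SmoothLoop c) (hh : SmoothLoop h)
    (hm : SmoothLoop m) (hi : ∀ t : ℝ, |t| < ε → IsImmersion (ct c m t)) (j : ℕ) :
    ContDiffOn ℝ (⊤ : ℕ∞) (HH c h m j) (slab ε) := by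
  induction j with
  | zero => exact (hh.1.comp contDiff_snd).contDiffOn
  | succ j ih =>
    have h1 : ContDiffOn ℝ (⊤ : ℕ∞) (fderiv ℝ (HH c h m j)) (slab ε) :=
      ih.fderiv_of_isOpen (isOpen_slab ε) (by simp)
    have h2 : ContDiffOn ℝ (⊤ : ℕ∞) (fun p : ℝ × ℝ => (speed (ct c m p.1) p.2)⁻¹ •
        fderiv ℝ (HH c h m j) p (0, 1)) (slab ε) :=
      ((speed_contDiffOn hc hm hi).inv fun p hp => (speed_pos (hi p.1 hp) p.2).ne').smul
        (h1.clm_apply contDiffOn_const)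
    refine h2.congr fun p hp => ?_
    exact HH_succ ((ih.contDiffAt ((isOpen_slab ε).mem_nhds hp)).differentiableAt (by simp))

theorem speed_hasDerivAt {c m : ℝ → R2} (hc : IsImmersion c) (hm : SmoothLoop m) (x : ℝ) :
    HasDerivAt (fun t => speed (ct c m t) x) (pfun c m x * speed c x) 0 := by
  have h : ∀ t, deriv (ct c m t) x = deriv c x + t • deriv m x := fun t =>
    ((SL.diff hc.1 x).hasDerivAt.add ((SL.diff hm x).hasDerivAt.const_smul t)).deriv
  have hn : ∀ t, speed (ct c m t) x
      = √(⟪deriv c x + t • deriv m x, deriv c x + t • deriv m x⟫ : ℝ) := fun t => by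
    rw [speed, h, real_inner_self_eq_norm_sq, Real.sqrt_sq (norm_nonneg _)]
  have hp := speed_pos hc x
  have d1 : HasDerivAt (fun t : ℝ => deriv c x + t • deriv m x) (deriv m x) 0 := by
    simpa using ((hasDerivAt_id (0:ℝ)).smul_const (deriv m x)).const_add (deriv c x)
  have d2 := (d1.inner ℝ d1).sqrt (by simpa using hc.2 x)
  simp only [hn]
  convert d2 using 1
  simp only [zero_smul, add_zero, real_inner_self_eq_norm_sq, Real.sqrt_sq (norm_nonneg _)]
  rw [pfun, Ds, tangentV, real_inner_smul_left, real_inner_smul_right, ← speed,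
    real_inner_comm (deriv m x) (deriv c x)]
  field_simp
  ring

theorem HH_hasDerivAt {c h m : ℝ → R2} {ε : ℝ} (hε : 0 < ε) (hc : IsImmersion c)
    (hh : SmoothLoop h)
    (hm : SmoothLoop m) (hi : ∀ t : ℝ, |t| < ε → IsImmersion (ct c m t)) (j : ℕ) (x : ℝ) :
    HasDerivAt (fun t => HH c h m j (t, x)) (Kvar c h m j x) 0 := by
  have hcd : ∀ j t x, |t| < ε → ContDiffAt ℝ (⊤ : ℕ∞) (HH c h m j) (t, x) := fun j t x ht =>
    (HH_contDiffOn hc.1 hh hm hi j).contDiffAt ((isOpen_slab ε).mem_nhds ht)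
  have hdd : ∀ j t x, |t| < ε → DifferentiableAt ℝ (HH c h m j) (t, x) := fun j t x ht =>
    (hcd j t x ht).differentiableAt (by simp)
  have h0 : |(0:ℝ)| < ε := by simpa using hε
  induction j generalizing x with
  | zero => exact hasDerivAt_const (0 : ℝ) (h x)
  | succ j ih =>
    have hK : (fun y => fderiv ℝ (HH c h m j) (0, y) (1, 0)) = Kvar c h m j := by
      funext y
      exact (hasDerivAt_fst (hdd j 0 y h0)).unique (ih y)
    have d1 := hasDerivAt_swap (hcd j 0 x h0)
    rw [hK] at d1
    have hp := speed_pos hc x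
    have d2 := (speed_hasDerivAt hc hm x).fun_inv (by rw [ct_zero]; exact hp.ne')
    have d3 := d2.fun_smul d1
    have ev : (fun t => HH c h m (j + 1) (t, x)) =ᶠ[nhds 0]
        fun t => (speed (ct c m t) x)⁻¹ • fderiv ℝ (HH c h m j) (t, x) (0, 1) := by
      have : ∀ᶠ t : ℝ in nhds 0, |t| < ε := by
        exact (isOpen_lt (by fun_prop) (by fun_prop)).mem_nhds h0
      filter_upwards [this] with t ht
      exact HH_succ (hdd j t x ht)
    refine (d3.congr_of_eventuallyEq ev).congr_deriv ?_
    have e1 : (Ds c)^[j + 1] h x = (speed c x)⁻¹ • fderiv ℝ (HH c h m j) (0, x) (0, 1) := by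
      have := HH_succ (hdd j 0 x h0)
      rw [ct_zero] at this
      rw [← this, HH, ct_zero]
    simp only [Kvar, ct_zero, e1]
    have : -(pfun c m x * speed c x) / speed c x ^ 2 = - (pfun c m x * (speed c x)⁻¹) := by
      field_simp
    rw [this, Ds]
    module

/-- Differentiation under the integral sign for smooth integrands. -/
theorem hasDerivAt_integral_slab {F : ℝ × ℝ → ℝ} {ε : ℝ} (hε : 0 < ε)
    (hF : ContDiffOn ℝ (⊤ : ℕ∞) F (slab ε)) :
    HasDerivAt (fun t => ∫ x in (0:ℝ)..(2 * π), F (t, x))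
      (∫ x in (0:ℝ)..(2 * π), fderiv ℝ F (0, x) (1, 0)) 0 := by
  have hcont : ContinuousOn (fun p => fderiv ℝ F p (1, 0)) (slab ε) :=
    ((hF.fderiv_of_isOpen (m := 0) (isOpen_slab ε) (by simp)).continuousOn).clm_apply
      continuousOn_const
  have hsub : Set.Icc (-(ε / 2)) (ε / 2) ×ˢ Set.Icc (0:ℝ) (2 * π) ⊆ slab ε := by
    rintro ⟨t, x⟩ ⟨ht, -⟩
    simp only [slab, Set.mem_ofPred_eq, abs_lt]
    exact ⟨by linarith [ht.1], by linarith [ht.2]⟩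
  obtain ⟨C, hC⟩ := (isCompact_Icc.prod isCompact_Icc).exists_bound_of_continuousOn
    (hcont.mono hsub)
  have hsl : ∀ (G : ℝ × ℝ → ℝ), ContinuousOn G (slab ε) → ∀ t, |t| < ε →
      Continuous fun x => G (t, x) := fun G hG t ht =>
    continuousOn_univ.1 (hG.comp (f := fun x => (t, x)) (by fun_prop) (fun x _ => ht))
  have h0 : |(0:ℝ)| < ε := by simpa using hε
  have hpi : (0:ℝ) ≤ 2 * π := by positivity
  refine (intervalIntegral.hasDerivAt_integral_of_dominated_loc_of_deriv_le
    (F := fun t x => F (t, x)) (F' := fun t x => fderiv ℝ F (t, x) (1, 0))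
    (s := Set.Icc (-(ε / 2)) (ε / 2)) (bound := fun _ => C)
    (Icc_mem_nhds (by linarith) (by linarith)) ?_ ?_ ?_ ?_ ?_ ?_).2
  · have : ∀ᶠ t : ℝ in nhds 0, |t| < ε :=
      (isOpen_lt (by fun_prop) (by fun_prop)).mem_nhds h0
    filter_upwards [this] with t ht
    exact (hsl F hF.continuousOn t ht).aestronglyMeasurable
  · exact (hsl F hF.continuousOn 0 h0).intervalIntegrable _ _
  · exact (hsl _ hcont 0 h0).aestronglyMeasurable
  · refine Filter.Eventually.of_forall fun x hx t ht => hC (t, x) ⟨ht, ?_⟩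
    rw [Set.uIoc_of_le hpi] at hx
    exact ⟨hx.1.le, hx.2⟩
  · exact intervalIntegrable_const
  · refine Filter.Eventually.of_forall fun x hx t ht => hasDerivAt_fst ?_
    rw [Set.uIoc_of_le hpi] at hx
    exact (hF.contDiffAt ((isOpen_slab ε).mem_nhds
      (hsub ⟨ht, ⟨hx.1.le, hx.2⟩⟩))).differentiableAt (by simp)

theorem deriv_sobolevG {c h m : ℝ → R2} {ε : ℝ} (hε : 0 < ε) (hc : IsImmersion c)
    (hh : SmoothLoop h) (hm : SmoothLoop m)
    (hi : ∀ t : ℝ, |t| < ε → IsImmersion (ct c m t)) (a : ℕ → ℝ) (n : ℕ) :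
    deriv (fun t => sobolevG a n (ct c m t) h h) 0
      = ∫ x in (0:ℝ)..(2 * π), ∑ j ∈ Finset.range (n + 1), a j *
        (2 * ((⟪Kvar c h m j x, (Ds c)^[j] h x⟫ : ℝ) * speed c x)
          + (pfun c m x * (⟪(Ds c)^[j] h x, (Ds c)^[j] h x⟫ : ℝ)) * speed c x) := by
  set F : ℝ × ℝ → ℝ := fun p => (∑ j ∈ Finset.range (n + 1),
      a j * (⟪HH c h m j p, HH c h m j p⟫ : ℝ)) * speed (ct c m p.1) p.2 with hFdef
  have hF : ContDiffOn ℝ (⊤ : ℕ∞) F (slab ε) := by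
    refine ContDiffOn.mul (ContDiffOn.sum fun j _ => contDiffOn_const.mul ?_)
      (speed_contDiffOn hc.1 hm hi)
    exact (HH_contDiffOn hc.1 hh hm hi j).inner ℝ (HH_contDiffOn hc.1 hh hm hi j)
  have h0 : |(0:ℝ)| < ε := by simpa using hε
  have hd := (hasDerivAt_integral_slab hε hF).deriv
  have e : (fun t => sobolevG a n (ct c m t) h h)
      = fun t => ∫ x in (0:ℝ)..(2 * π), F (t, x) := rfl
  rw [e, hd]
  congr 1; ext x
  have hdF : DifferentiableAt ℝ F (0, x) :=
    (hF.contDiffAt ((isOpen_slab ε).mem_nhds h0)).differentiableAt (by simp)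
  refine (hasDerivAt_fst hdF).unique ?_
  have d1 := fun j => HH_hasDerivAt hε hc hh hm hi j x
  have d2 := (HasDerivAt.fun_sum (u := Finset.range (n + 1)) fun j _ =>
    ((d1 j).inner ℝ (d1 j)).const_mul (a j)).fun_mul (speed_hasDerivAt hc hm x)
  refine d2.congr_deriv ?_
  simp only [HH, ct_zero]
  rw [Finset.sum_mul, Finset.sum_mul, ← Finset.sum_add_distrib]
  refine Finset.sum_congr rfl fun j _ => ?_
  rw [real_inner_comm (Kvar c h m j x)]
  ring

theorem main {c h m : ℝ → R2} {ε : ℝ} (hε : 0 < ε) (hc : IsImmersion c)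
    (hh : SmoothLoop h) (hm : SmoothLoop m)
    (hi : ∀ t : ℝ, |t| < ε → IsImmersion (ct c m t)) (a : ℕ → ℝ) (n : ℕ) :
    deriv (fun t => sobolevG a n (ct c m t) h h) 0
      = ∫ x in (0:ℝ)..(2 * π), - ((⟪m x, (2 * (⟪Lop a n c h x, Ds c h x⟫ : ℝ)) • tangentV c x
        + ((∑ k ∈ Finset.range (n + 1), a k * Wk c h k x) * curv c x) • normalV c x⟫ : ℝ)
          * speed c x) := by
  have hs := SL.speed hc
  have hp := SL.pfun hc hm
  have hD := SL.DsIter hc hh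
  have hK := SL.Kvar hc hh hm
  have hW : SmoothLoop (fun x => ∑ k ∈ Finset.range (n + 1), a k * Wk c h k x) :=
    SL.sum fun k => SL.mul (SL.const _) (SL.Wk hc hh k)
  have i1 := fun j => SL.int (SL.mul (SL.inner (hK j) (hD j)) hs)
  have i2 := fun j => SL.int (SL.mul (SL.mul hp (SL.inner (hD j) (hD j))) hs)
  have i3 := fun k => SL.int (SL.mul (SL.mul hp (SL.Wk hc hh k)) hs)
  have step : ∀ j, ∫ x in (0:ℝ)..(2 * π),
        (2 * ((⟪Kvar c h m j x, (Ds c)^[j] h x⟫ : ℝ) * speed c x)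
          + (pfun c m x * (⟪(Ds c)^[j] h x, (Ds c)^[j] h x⟫ : ℝ)) * speed c x)
      = ∫ x in (0:ℝ)..(2 * π), pfun c m x * Wk c h j x * speed c x := by
    intro j
    have i4 : SmoothLoop fun x => (pfun c m x * ∑ i ∈ Finset.range j,
          (-1 : ℝ) ^ i * (⟪(Ds c)^[j - i] h x, (Ds c)^[i] ((Ds c)^[j] h) x⟫ : ℝ)) * speed c x :=
      SL.mul (SL.mul hp (SL.sum fun i => SL.mul (SL.const _)
        (SL.inner (hD _) (SL.DsIter hc (hD j) _)))) hs
    rw [intervalIntegral.integral_add ((i1 j).const_mul 2) (i2 j),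
      intervalIntegral.integral_const_mul, Kvar_integral hc hh hm j _ (hD j), mul_neg,
      ← intervalIntegral.integral_const_mul, ← sub_eq_neg_add,
      ← intervalIntegral.integral_sub (i2 j) ((SL.int i4).const_mul 2)]
    congr 1; ext x
    simp only [← Function.iterate_add_apply, Wk]
    simp only [add_comm j]
    ring
  rw [deriv_sobolevG hε hc hh hm hi, intervalIntegral.integral_finsetSum
    (fun j _ => (((i1 j).const_mul 2).add (i2 j)).const_mul (a j))]
  simp only [intervalIntegral.integral_const_mul, step]
  simp only [← intervalIntegral.integral_const_mul]
  rw [← intervalIntegral.integral_finsetSum (fun j _ => (i3 j).const_mul (a j))]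
  have e1 : ∀ x, ∑ j ∈ Finset.range (n + 1), a j * (pfun c m x * Wk c h j x * speed c x)
      = (⟪Ds c m x, (∑ k ∈ Finset.range (n + 1), a k * Wk c h k x) • tangentV c x⟫ : ℝ)
        * speed c x := by
    intro x
    rw [real_inner_smul_right, Finset.sum_mul, Finset.sum_mul]
    refine Finset.sum_congr rfl fun j _ => ?_
    rw [pfun]; ring
  simp only [e1]
  rw [ibp hc hm (SL.smul hW (SL.tangent hc)), ← intervalIntegral.integral_neg]
  congr 1; ext x
  rw [Ds_smul hW (SL.tangent hc), Ds_tangent hc, smul_smul]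
  have e2 : Ds c (fun x => ∑ k ∈ Finset.range (n + 1), a k * Wk c h k x) x
      = 2 * (⟪Lop a n c h x, Ds c h x⟫ : ℝ) := by
    have e3 : Ds c (fun x => ∑ k ∈ Finset.range (n + 1), a k * Wk c h k x) x
        = ∑ k ∈ Finset.range (n + 1), a k * Ds c (Wk c h k) x := by
      simp only [Ds, smul_eq_mul]
      rw [deriv_fun_sum (fun k _ => SL.diff (SL.mul (SL.const _) (SL.Wk hc hh k)) x),
        Finset.mul_sum]
      refine Finset.sum_congr rfl fun k _ => ?_
      rw [deriv_const_mul _ (SL.diff (SL.Wk hc hh k) x)]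
      ring
    rw [e3, Lop, sum_inner, Finset.mul_sum]
    refine Finset.sum_congr rfl fun k _ => ?_
    rw [Ds_Wk hc hh, real_inner_smul_left]
    ring
  rw [e2]

end FirstVar

/-- first variation formula for the Sobolev metric. -/
theorem statement_18 (n : ℕ) (hn : 1 ≤ n) (a : ℕ → ℝ) (ha : ∀ j ≤ n, 0 ≤ a j)
    (c h m : ℝ → R2) (hc : IsImmersion c) (hh : SmoothLoop h) (hm : SmoothLoop m)
    (hsmall : ∃ ε : ℝ, 0 < ε ∧ ∀ t : ℝ, |t| < ε → IsImmersion (fun x => c x + t • m x)) :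
    deriv (fun t : ℝ => sobolevG a n (fun x => c x + t • m x) h h) 0
      = ∫ θ in (0:ℝ)..(2 * π),
          (⟪(-2 * (⟪Lop a n c h θ, Ds c h θ⟫ : ℝ)) • tangentV c θ
              - (a 0 * (⟪h θ, h θ⟫ : ℝ) * curv c θ) • normalV c θ
              + ∑ k ∈ Finset.Icc 1 n, ∑ j ∈ Finset.Icc 1 (2 * k - 1),
                  ((-1 : ℝ) ^ (k + j) * a k
                      * (⟪(Ds c)^[2 * k - j] h θ, (Ds c)^[j] h θ⟫ : ℝ) * curv c θ) •
                    normalV c θ,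
            m θ⟫ : ℝ) * speed c θ := by
  obtain ⟨ε, hε, hi⟩ := hsmall
  refine (FirstVar.main hε hc hh hm hi a n).trans ?_
  congr 1; ext x
  rw [← neg_mul]
  congr 1
  rw [real_inner_comm, ← inner_neg_left]
  congr 1
  have e1 : ∑ k ∈ Finset.range (n + 1), a k * FirstVar.Wk c h k x
      = a 0 * (⟪h x, h x⟫ : ℝ) + ∑ k ∈ Finset.Icc 1 n, a k * FirstVar.Wk c h k x := by
    rw [Finset.range_eq_Ico, Finset.sum_eq_sum_Ico_succ_bot (by omega)]
    congr 1
    simp [FirstVar.Wk]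
  have e2 : ∑ k ∈ Finset.Icc 1 n, ∑ j ∈ Finset.Icc 1 (2 * k - 1),
                  ((-1 : ℝ) ^ (k + j) * a k
                      * (⟪(Ds c)^[2 * k - j] h x, (Ds c)^[j] h x⟫ : ℝ) * curv c x) •
                    normalV c x
      = (-(∑ k ∈ Finset.Icc 1 n, a k * FirstVar.Wk c h k x) * curv c x) • normalV c x := by
    rw [← Finset.sum_neg_distrib, Finset.sum_mul, Finset.sum_smul]
    refine Finset.sum_congr rfl fun k hk => ?_
    rw [← Finset.sum_smul]
    congr 1
    rw [← mul_neg, ← FirstVar.Wk_eq_sum c h k (Finset.mem_Icc.1 hk).1, Finset.mul_sum,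
      Finset.sum_mul]
    refine Finset.sum_congr rfl fun j _ => ?_
    ring
  rw [e1, e2]
  module
end
end

section
/- Let n ≥ 2 and a_2, …, a_n ≥ 0 be constants (coefficients a_0 = a_1 = 0), and let G be the Sobolev metric G_c(h,k) = ∫_{S¹} Σ_{j=2}^n a_j ⟨D_s^j h, D_s^j k⟩ |c'| dθ. Let r : [0,1] → (0,∞) be smooth and let c(t,θ) = r(t)·(cos θ, sin θ) be the corresponding path of concentric circles. Then: (i) for all t, G_{c(t,·)}(∂_t c, ∂_t c) = 2π · Σ_{j=2}^n a_j · r(t)^{1−2j} · (r'(t))²; (ii) if r is strictly increasing, Len^G(c) = √(2π) · ∫_{r(0)}^{r(1)} √( Σ_{j=2}^n a_j σ^{1−2j} ) dσ; and (iii) for every r_0 > 0 the improper integral ∫_{r_0}^{∞} √( Σ_{j=2}^n a_j σ^{1−2j} ) dσ is finite, so circles can be blown up to infinity along paths of finite G-length. -/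
noncomputable section
open Real MeasureTheory intervalIntegral
open scoped RealInnerProductSpace

/-- The Sobolev metric with coefficients `a_2, …, a_n` (and `a_0 = a_1 = 0`):
`G_c(h,k) = ∫ Σ_{j=2}^n a_j ⟨D_s^j h, D_s^j k⟩ |c'| dθ`. -/
def sobolevG2 (a : ℕ → ℝ) (n : ℕ) (c h k : ℝ → R2) : ℝ :=
  ∫ θ in (0:ℝ)..(2 * π),
    (∑ j ∈ Finset.Icc 2 n,
      a j * (⟪(Ds c)^[j] h θ, (Ds c)^[j] k θ⟫ : ℝ)) * speed c θ

/-- The concentric-circles path `c(t,θ) = r(t)·(cos θ, sin θ)`. -/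
def circlePath (r : ℝ → ℝ) (t θ : ℝ) : R2 :=
  (WithLp.equiv 2 (Fin 2 → ℝ)).symm ![r t * Real.cos θ, r t * Real.sin θ]

/-- The unit vector at angle `φ`. -/
def unitE (φ : ℝ) : R2 := WithLp.toLp 2 ![Real.cos φ, Real.sin φ]

lemma circlePath_eq (r : ℝ → ℝ) (t θ : ℝ) : circlePath r t θ = r t • unitE θ := by
  ext i
  fin_cases i <;> simp [circlePath, unitE]

lemma hasDerivAt_unitE (φ : ℝ) : HasDerivAt unitE (unitE (φ + π / 2)) φ := by
  have h : HasDerivAt (fun φ : ℝ => (![Real.cos φ, Real.sin φ] : Fin 2 → ℝ))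
      ![Real.cos (φ + π / 2), Real.sin (φ + π / 2)] φ := by
    rw [hasDerivAt_pi]
    intro i
    fin_cases i
    · simpa [Real.cos_add_pi_div_two] using Real.hasDerivAt_cos φ
    · simpa [Real.sin_add_pi_div_two] using Real.hasDerivAt_sin φ
  exact ((PiLp.continuousLinearEquiv 2 ℝ (fun _ : Fin 2 => ℝ)).symm.hasFDerivAt.comp_hasDerivAt φ h)

lemma inner_unitE (φ : ℝ) : (⟪unitE φ, unitE φ⟫ : ℝ) = 1 := by
  simp only [unitE, PiLp.inner_apply, Fin.sum_univ_two]
  simp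

lemma norm_unitE (φ : ℝ) : ‖unitE φ‖ = 1 := by
  have h := real_inner_self_eq_norm_sq (unitE φ)
  rw [inner_unitE] at h
  nlinarith [norm_nonneg (unitE φ)]

lemma speed_circlePath (r : ℝ → ℝ) (t : ℝ) (h : 0 < r t) (θ : ℝ) :
    speed (circlePath r t) θ = r t := by
  have h1 : circlePath r t = fun θ => r t • unitE θ := funext (circlePath_eq r t)
  rw [speed, h1, ((hasDerivAt_unitE θ).fun_const_smul (r t)).deriv, norm_smul, norm_unitE]
  simp [abs_of_pos h]

lemma iter_Ds (r : ℝ → ℝ) (t : ℝ) (h : 0 < r t) (b : ℝ) (j : ℕ) :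
    (Ds (circlePath r t))^[j] (fun θ => b • unitE θ)
      = fun θ => ((r t)⁻¹ ^ j * b) • unitE (θ + j * (π / 2)) := by
  induction j with
  | zero => simp
  | succ k ih =>
    rw [Function.iterate_succ_apply', ih]
    funext θ
    have h2 : HasDerivAt (fun θ => ((r t)⁻¹ ^ k * b) • unitE (θ + k * (π / 2)))
        (((r t)⁻¹ ^ k * b) • unitE (θ + k * (π / 2) + π / 2)) θ :=
      ((hasDerivAt_unitE (θ + k * (π / 2))).comp_add_const θ _).fun_const_smul _
    rw [Ds, speed_circlePath r t h, h2.deriv, smul_smul]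
    congr 1
    · ring
    · congr 1; push_cast; ring

lemma part_one (n : ℕ) (a : ℕ → ℝ) (r : ℝ → ℝ) (hr : ContDiff ℝ (⊤ : ℕ∞) r) (t : ℝ)
    (h : 0 < r t) :
    sobolevG2 a n (circlePath r t)
            (fun θ => deriv (fun τ => circlePath r τ θ) t)
            (fun θ => deriv (fun τ => circlePath r τ θ) t)
          = 2 * π * ∑ j ∈ Finset.Icc 2 n,
              a j * r t ^ ((1:ℤ) - 2 * (j:ℤ)) * deriv r t ^ 2 := by
  have hd : (fun θ => deriv (fun τ => circlePath r τ θ) t)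
      = fun θ => deriv r t • unitE θ := by
    funext θ
    have h1 : (fun τ => circlePath r τ θ) = fun τ => r τ • unitE θ :=
      funext fun τ => circlePath_eq r τ θ
    have h2 : HasDerivAt r (deriv r t) t :=
      ((hr.differentiable (by simp)) t).hasDerivAt
    rw [h1]
    exact (h2.smul_const (unitE θ)).deriv
  rw [hd, sobolevG2]
  simp only [iter_Ds r t h, speed_circlePath r t h, inner_smul_left, inner_smul_right, inner_unitE]
  rw [intervalIntegral.integral_const, smul_eq_mul, Finset.sum_mul, sub_zero]
  congr 1
  refine Finset.sum_congr rfl fun j _ => ?_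
  have : r t ^ ((1:ℤ) - 2 * (j:ℤ)) = r t * ((r t)⁻¹ ^ j * (r t)⁻¹ ^ j) := by
    rw [zpow_sub₀ h.ne', zpow_one, two_mul, zpow_add₀ h.ne', zpow_natCast, inv_pow]
    field_simp
  rw [this]
  simp
  ring

lemma cont_S (n : ℕ) (a : ℕ → ℝ) :
    ContinuousOn (fun σ : ℝ => Real.sqrt (∑ j ∈ Finset.Icc 2 n, a j * σ ^ ((1:ℤ) - 2 * (j:ℤ))))
      (Set.Ioi 0) := by
  refine ContinuousOn.sqrt ?_
  refine continuousOn_finsetSum _ fun j _ => continuousOn_const.mul ?_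
  exact continuousOn_id.zpow₀ _ fun x hx => Or.inl (ne_of_gt hx)

lemma part_three (n : ℕ) (a : ℕ → ℝ) (ha : ∀ j : ℕ, 2 ≤ j → j ≤ n → 0 ≤ a j) (r₀ : ℝ)
    (h0 : 0 < r₀) :
    IntegrableOn
          (fun σ => Real.sqrt (∑ j ∈ Finset.Icc 2 n, a j * σ ^ ((1:ℤ) - 2 * (j:ℤ))))
          (Set.Ioi r₀) := by
  have hint := (integrableOn_Ioi_rpow_of_lt (a := (-3/2 : ℝ)) (by norm_num) h0).mul_const
    (Real.sqrt (∑ j ∈ Finset.Icc 2 n, a j * (r₀ ^ (2 * (j - 2)))⁻¹))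
  refine Integrable.mono' hint ?_ ?_
  · exact ((cont_S n a).mono (Set.Ioi_subset_Ioi h0.le)).aestronglyMeasurable measurableSet_Ioi
  · refine (ae_restrict_iff' measurableSet_Ioi).2 (Filter.Eventually.of_forall fun σ hσ => ?_)
    have hσ' : r₀ < σ := hσ
    have hp : 0 < σ := h0.trans hσ'
    rw [Real.norm_of_nonneg (Real.sqrt_nonneg _)]
    have e : σ ^ (-3/2 : ℝ) = Real.sqrt ((σ ^ 3)⁻¹) := by
      rw [Real.sqrt_eq_rpow, ← Real.rpow_natCast, ← Real.rpow_neg hp.le, ← Real.rpow_mul hp.le]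
      norm_num
    rw [e, ← Real.sqrt_mul (by positivity), Finset.mul_sum]
    refine Real.sqrt_le_sqrt (Finset.sum_le_sum fun j hj => ?_)
    rw [Finset.mem_Icc] at hj
    have haj := ha j hj.1 hj.2
    obtain ⟨k, rfl⟩ := Nat.exists_eq_add_of_le hj.1
    have e2 : σ ^ ((1:ℤ) - 2 * ((2 + k : ℕ):ℤ)) = (σ ^ 3)⁻¹ * (σ ^ (2 * k))⁻¹ := by
      rw [← mul_inv, ← pow_add, ← zpow_natCast, ← zpow_neg]
      congr 1; push_cast; ring
    rw [e2, Nat.add_sub_cancel_left, mul_left_comm]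
    gcongr

lemma part_two (n : ℕ) (a : ℕ → ℝ)
    (r : ℝ → ℝ) (hr : ContDiff ℝ (⊤ : ℕ∞) r) (hrpos : ∀ t ∈ Set.Icc (0:ℝ) 1, 0 < r t)
    (hm : StrictMonoOn r (Set.Icc (0:ℝ) 1)) :
    pathLen (sobolevG2 a n) (circlePath r)
          = Real.sqrt (2 * π) * ∫ σ in (r 0)..(r 1),
              Real.sqrt (∑ j ∈ Finset.Icc 2 n, a j * σ ^ ((1:ℤ) - 2 * (j:ℤ))) := by
  have hdiff : Differentiable ℝ r := hr.differentiable (by simp)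
  have hcd : Continuous (deriv r) := hr.continuous_deriv (by simp)
  have hu : Set.uIcc (0:ℝ) 1 = Set.Icc 0 1 := Set.uIcc_of_le zero_le_one
  have key := intervalIntegral.integral_comp_mul_deriv' (a := (0:ℝ)) (b := 1) (f := r)
    (f' := deriv r)
    (g := fun σ => Real.sqrt (∑ j ∈ Finset.Icc 2 n, a j * σ ^ ((1:ℤ) - 2 * (j:ℤ))))
    (fun x _ => (hdiff x).hasDerivAt) hcd.continuousOn
    ((cont_S n a).mono (by
      rw [hu]
      rintro _ ⟨x, hx, rfl⟩
      exact hrpos x hx))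
  rw [← key, pathLen, ← intervalIntegral.integral_const_mul]
  refine intervalIntegral.integral_congr fun t ht => ?_
  rw [hu] at ht
  have hd : 0 ≤ deriv r t := by
    rw [← (hdiff t).derivWithin (uniqueDiffOn_Icc zero_lt_one t ht)]
    exact hm.monotoneOn.derivWithin_nonneg
  simp only [Function.comp]
  rw [part_one n a r hr t (hrpos t ht), ← Finset.sum_mul, Real.sqrt_mul (by positivity),
    Real.sqrt_mul' _ (sq_nonneg _), Real.sqrt_sq hd]

/-- blow-up of circles in finite length for Sobolev metrics with
`a_0 = a_1 = 0`. -/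
theorem statement_19 (n : ℕ) (hn : 2 ≤ n) (a : ℕ → ℝ)
    (ha : ∀ j : ℕ, 2 ≤ j → j ≤ n → 0 ≤ a j)
    (r : ℝ → ℝ) (hr : ContDiff ℝ (⊤ : ℕ∞) r) (hrpos : ∀ t ∈ Set.Icc (0:ℝ) 1, 0 < r t) :
    (∀ t ∈ Set.Icc (0:ℝ) 1,
        sobolevG2 a n (circlePath r t)
            (fun θ => deriv (fun τ => circlePath r τ θ) t)
            (fun θ => deriv (fun τ => circlePath r τ θ) t)
          = 2 * π * ∑ j ∈ Finset.Icc 2 n,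
              a j * r t ^ ((1:ℤ) - 2 * (j:ℤ)) * deriv r t ^ 2) ∧
    (StrictMonoOn r (Set.Icc (0:ℝ) 1) →
        pathLen (sobolevG2 a n) (circlePath r)
          = Real.sqrt (2 * π) * ∫ σ in (r 0)..(r 1),
              Real.sqrt (∑ j ∈ Finset.Icc 2 n, a j * σ ^ ((1:ℤ) - 2 * (j:ℤ)))) ∧
    (∀ r₀ : ℝ, 0 < r₀ →
        IntegrableOn
          (fun σ => Real.sqrt (∑ j ∈ Finset.Icc 2 n, a j * σ ^ ((1:ℤ) - 2 * (j:ℤ))))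
          (Set.Ioi r₀)) := by
  exact ⟨fun t ht => part_one n a r hr t (hrpos t ht), part_two n a r hr hrpos,
    fun r₀ h0 => part_three n a ha r₀ h0⟩
end
end
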